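/- Let \(\mathsf{D}\) be a finite-dimensional graded division algebra with center \(\mathsf{F}\), with canonical subalgebras \(\mathsf{Z}\) and \(\mathsf{C}\), and let \(\mathsf{M}\) be a maximal graded subfield of \(\mathsf{D}\). Then \(\mathsf{M}_0\) is a maximal subfield of \(\mathsf{D}_0\) if and only if \(\mathsf{M}\supseteq\mathsf{Z}\) and \(|\Gamma_{\mathsf{M}}:\Gamma_{\mathsf{Z}}|=\deg\mathsf{C}\). In particular, this holds whenever \(\mathsf{M}\cap\mathsf{C}\) is a maximal graded subfield of \(\mathsf{C}\). -/

import Mathlib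

noncomputable section

namespace GradedDivPaper

variable {Γ : Type*} [AddCommGroup Γ] [DecidableEq Γ]
variable {D : Type*} [Ring D]

/-- The (additive) group `Γ` is torsion-free. -/
def TorsionFree (Γ : Type*) [AddCommGroup Γ] : Prop :=
  ∀ (γ : Γ) (n : ℕ), n ≠ 0 → n • γ = 0 → γ = 0

/-- A `Γ`-graded ring is a graded division ring if `1 ≠ 0` and every nonzero
homogeneous element is a unit. -/
def IsGradedDivisionRing (𝒜 : Γ → AddSubgroup D) [GradedRing 𝒜] : Prop :=
  (0 : D) ≠ 1 ∧ ∀ (γ : Γ), ∀ x ∈ 𝒜 γ, x ≠ 0 → IsUnit x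

/-- A subring `E` of a graded ring is a graded subring if it contains all homogeneous
components of each of its elements. -/
def IsGradedSubring (𝒜 : Γ → AddSubgroup D) [GradedRing 𝒜] (E : Subring D) : Prop :=
  ∀ x ∈ E, ∀ γ : Γ, (DirectSum.decompose 𝒜 x γ : D) ∈ E

/-- A graded subring which is itself a graded division ring (nonzero homogeneous elements
of `E` are invertible in `E`). -/
def IsGradedDivSubring (𝒜 : Γ → AddSubgroup D) [GradedRing 𝒜] (E : Subring D) : Prop :=
  IsGradedSubring 𝒜 E ∧
    ∀ (γ : Γ), ∀ x ∈ E, x ∈ 𝒜 γ → x ≠ 0 → ∃ y ∈ E, x * y = 1 ∧ y * x = 1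

/-- A graded subfield: a commutative graded division subring. -/
def IsGradedSubfield (𝒜 : Γ → AddSubgroup D) [GradedRing 𝒜] (K : Subring D) : Prop :=
  IsGradedDivSubring 𝒜 K ∧ ∀ x ∈ K, ∀ y ∈ K, x * y = y * x

/-- The grade set `Γ_E` of a subring `E`: the degrees in which `E` has nonzero
homogeneous elements. -/
def gradeSet (𝒜 : Γ → AddSubgroup D) (E : Subring D) : Set Γ :=
  {γ : Γ | ∃ x : D, x ∈ E ∧ x ∈ 𝒜 γ ∧ x ≠ 0}

/-- The index `|A : B|` of subsets of `Γ`: the number of classes of `A` modulo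
translation by `B`. -/
def addSetIndex (A B : Set Γ) : ℕ :=
  Nat.card (Quot (fun x y : A => (x : Γ) - (y : Γ) ∈ B))

/-- `[R : S]`: the rank of the ring `R` as a module over a subring `S`. -/
def dimOver {R : Type*} [Ring R] (S : Subring R) : ℕ := Module.finrank S R

/-- `R` has finite rank over the subring `S`. -/
def finiteOver {R : Type*} [Ring R] (S : Subring R) : Prop := Module.Finite S R

/-- `[A : B]`: the rank of a subring `A` of `R` over a subring `B` (i.e. over `B ∩ A`). -/
def relDim {R : Type*} [Ring R] (B A : Subring R) : ℕ :=
  Module.finrank (B.comap A.subtype) A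

/-- The degree-0 component of a graded ring, as a subring. -/
def grade0 (𝒜 : Γ → AddSubgroup D) [GradedRing 𝒜] : Subring D where
  carrier := 𝒜 0
  zero_mem' := (𝒜 0).zero_mem
  add_mem' := fun ha hb => (𝒜 0).add_mem ha hb
  neg_mem' := fun ha => (𝒜 0).neg_mem ha
  one_mem' := SetLike.one_mem_graded 𝒜
  mul_mem' := fun ha hb => by simpa using SetLike.mul_mem_graded ha hb

/-- `L/F` is a Galois extension (inside an ambient ring `R`): `F ≤ L` and `F` is exactly
the fixed ring of the group of ring automorphisms of `L` fixing `F` pointwise. -/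
def IsGaloisExt {R : Type*} [Ring R] (F L : Subring R) : Prop :=
  F ≤ L ∧ ∀ x : L,
    (∀ σ : L ≃+* L, (∀ y : L, (y : R) ∈ F → σ y = y) → σ x = x) → (x : R) ∈ F

/-- `p` is the minimal polynomial of `c` over the subring `F`: the monic polynomial with
coefficients in `F` annihilating `c` of least degree. -/
def IsMinPolyOf {R : Type*} [Ring R] (F : Subring R) (c : R) (p : Polynomial F) : Prop :=
  p.Monic ∧ Polynomial.eval₂ F.subtype c p = 0 ∧
    ∀ q : Polynomial F, q.Monic → Polynomial.eval₂ F.subtype c q = 0 → p.degree ≤ q.degree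

/-- The polynomial `p` over `F` splits into linear factors over `L`. -/
def SplitsIn {R : Type*} [Ring R] {F L : Subring R} (h : F ≤ L) (p : Polynomial F) : Prop :=
  ∃ s : List L,
    p.map (Subring.inclusion h) = (s.map fun a => Polynomial.X - Polynomial.C a).prod

/-- Normality for an extension of graded subfields: the minimal polynomial over `F` of
every homogeneous element of `L` splits over `L`. -/
def IsNormalExtGr (𝒜 : Γ → AddSubgroup D) [GradedRing 𝒜] (F L : Subring D) : Prop :=
  ∃ h : F ≤ L, ∀ c ∈ L, (∃ γ : Γ, c ∈ 𝒜 γ) →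
    ∀ p : Polynomial F, IsMinPolyOf F c p → SplitsIn h p

/-- Normality for an (ungraded) extension of subfields: the minimal polynomial over `F`
of every element of `L` splits over `L`. -/
def IsNormalExt {R : Type*} [Ring R] (F L : Subring R) : Prop :=
  ∃ h : F ≤ L, ∀ c ∈ L, ∀ p : Polynomial F, IsMinPolyOf F c p → SplitsIn h p

/-- `K` is a (commutative) subfield of the subring `A`. -/
def IsSubfieldOf {R : Type*} [Ring R] (A K : Subring R) : Prop :=
  K ≤ A ∧ (∀ x ∈ K, ∀ y ∈ K, x * y = y * x) ∧
    ∀ x ∈ K, x ≠ 0 → ∃ y ∈ K, x * y = 1 ∧ y * x = 1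

/-- `K` is a maximal subfield of the subring `A`. -/
def IsMaxSubfieldOf {R : Type*} [Ring R] (A K : Subring R) : Prop :=
  IsSubfieldOf A K ∧ ∀ K' : Subring R, IsSubfieldOf A K' → K ≤ K' → K' = K

/-- `T` is a maximal graded subfield of the graded subring `A`. -/
def IsMaxGradedSubfieldOf (𝒜 : Γ → AddSubgroup D) [GradedRing 𝒜] (A T : Subring D) : Prop :=
  IsGradedSubfield 𝒜 T ∧ T ≤ A ∧
    ∀ T' : Subring D, IsGradedSubfield 𝒜 T' → T' ≤ A → T ≤ T' → T' = T

/-- The canonical subalgebra `𝖴 = 𝖣₀ ⊗_{𝖥₀} 𝖥`: the subring generated by `𝖣₀` and `𝖥`. -/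
def Uc (𝒜 : Γ → AddSubgroup D) [GradedRing 𝒜] (F : Subring D) : Subring D :=
  grade0 𝒜 ⊔ F

/-- The canonical subalgebra `𝖹 = Z(𝖣₀) ⊗_{𝖥₀} 𝖥`: the subring generated by the center
of `𝖣₀` and `𝖥`. -/
def Zc (𝒜 : Γ → AddSubgroup D) [GradedRing 𝒜] (F : Subring D) : Subring D :=
  (Subring.centralizer (grade0 𝒜 : Set D) ⊓ grade0 𝒜) ⊔ F

/-- The canonical subalgebra `𝖢 = C_𝖣(𝖴)`. -/
def Cc (𝒜 : Γ → AddSubgroup D) [GradedRing 𝒜] (F : Subring D) : Subring D :=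
  Subring.centralizer (Uc 𝒜 F : Set D)

/-- The canonical subalgebra `𝖤 = C_𝖣(𝖹)`. -/
def Ec (𝒜 : Γ → AddSubgroup D) [GradedRing 𝒜] (F : Subring D) : Subring D :=
  Subring.centralizer (Zc 𝒜 F : Set D)

end GradedDivPaper

namespace GradedDivPaper

/-- Over a central division algebra `A`, right multiplications by linearly independent elements
are linearly independent under left multiplication by `A`. -/
theorem eq_zero_of_forall_sum_mul_mul_eq_zero {K A ι : Type*} [Field K] [DivisionRing A]
    [Algebra K A] [Algebra.IsCentral K A] {e : ι → A} (he : LinearIndependent K e)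
    (s : Finset ι) : ∀ a : ι → A, (∀ x : A, ∑ i ∈ s, a i * x * e i = 0) → ∀ i ∈ s, a i = 0 := by
  classical
  induction s using Finset.induction_on with
  | empty => simp
  | insert j s hj ih =>
    intro a ha
    have haj : a j = 0 := by
      by_contra hne
      have hcen : ∀ i ∈ s, ∃ k : K, algebraMap K A k = (a j)⁻¹ * a i := by
        intro i hi
        have hcomm : ∀ y : A, (a j)⁻¹ * a i * y = y * ((a j)⁻¹ * a i) := by
          intro y
          have h0 := ih (fun i => (a j)⁻¹ * a i * y - y * ((a j)⁻¹ * a i)) (fun x => ?_) i hi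
          · exact sub_eq_zero.mp h0
          have h1 := congrArg ((a j)⁻¹ * ·) (ha (y * x))
          have h2 := congrArg (y * (a j)⁻¹ * ·) (ha x)
          simp only [Finset.sum_insert hj, mul_add, mul_zero, Finset.mul_sum] at h1 h2
          have e1 : (a j)⁻¹ * (a j * (y * x) * e j) = y * x * e j := by
            simp only [← mul_assoc]; rw [inv_mul_cancel₀ hne, one_mul]
          have e2 : y * (a j)⁻¹ * (a j * x * e j) = y * x * e j := by
            simp only [← mul_assoc]; rw [mul_assoc y, inv_mul_cancel₀ hne, mul_one]
          rw [e1] at h1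
          rw [e2] at h2
          have h3 := (add_left_cancel (h1.trans h2.symm))
          rw [← sub_eq_zero, ← Finset.sum_sub_distrib] at h3
          rw [← h3]
          refine Finset.sum_congr rfl fun i _ => ?_
          noncomm_ring
        have hmem : (a j)⁻¹ * a i ∈ Subalgebra.center K A :=
          Subalgebra.mem_center_iff.mpr fun y => (hcomm y).symm
        rw [Algebra.IsCentral.center_eq_bot] at hmem
        exact Algebra.mem_bot.mp hmem
      choose! k hk using hcen
      have h1 := congrArg ((a j)⁻¹ * ·) (ha 1)
      simp only [Finset.sum_insert hj, mul_add, mul_zero, Finset.mul_sum, mul_one,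
        ← mul_assoc, inv_mul_cancel₀ hne, one_mul] at h1
      have hli := linearIndependent_iff'.mp he (insert j s) (fun i => if i = j then 1 else k i) ?_ j
        (Finset.mem_insert_self j s)
      · simp at hli
      rw [Finset.sum_insert hj, ← h1]
      congr 1
      · simp
      · refine Finset.sum_congr rfl fun i hi => ?_
        rw [if_neg (ne_of_mem_of_not_mem hi hj), Algebra.smul_def, hk i hi]
    intro i hi
    rcases Finset.mem_insert.mp hi with rfl | hi
    · exact haj
    · refine ih a (fun x => ?_) i hi
      simpa [Finset.sum_insert hj, haj] using ha x

/-- A form of the Skolem–Noether theorem for central division algebras. -/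
theorem exists_ne_zero_mul_eq_map_mul {K A : Type*} [Field K] [DivisionRing A] [Algebra K A]
    [Algebra.IsCentral K A] [FiniteDimensional K A] (σ : A →ₐ[K] A) :
    ∃ a : A, a ≠ 0 ∧ ∀ y, a * y = σ y * a := by
  classical
  let b := Module.finBasis K A
  let φ : Fin (Module.finrank K A) → (A →ₗ[K] A) := fun i => LinearMap.mulRight K (b i)
  have hφ : LinearIndependent A φ := by
    rw [Fintype.linearIndependent_iff]
    intro g hg i
    refine eq_zero_of_forall_sum_mul_mul_eq_zero b.linearIndependent Finset.univ g (fun x => ?_) i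
      (Finset.mem_univ i)
    have := LinearMap.congr_fun hg x
    simpa [φ, mul_assoc] using this
  let E := (b.constr A : (Fin (Module.finrank K A) → A) ≃ₗ[A] (A →ₗ[K] A))
  have hcard : Fintype.card (Fin (Module.finrank K A)) = Module.finrank A (A →ₗ[K] A) := by
    rw [← E.finrank_eq, Module.finrank_fin_fun, Fintype.card_fin]
  have : Module.Finite A (A →ₗ[K] A) := Module.Finite.equiv E
  have hspan := hφ.span_eq_top_of_card_eq_finrank' hcard
  have hσ : σ.toLinearMap ∈ Submodule.span A (Set.range φ) := hspan ▸ Submodule.mem_top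
  obtain ⟨a, ha⟩ := (Submodule.mem_span_range_iff_exists_fun A).mp hσ
  have hax : ∀ x, ∑ i, a i * x * b i = σ x := fun x => by
    have := LinearMap.congr_fun ha x
    simpa [φ, mul_assoc] using this
  have hne : ∃ i, a i ≠ 0 := by
    by_contra! h
    have := hax 1
    simp [h] at this
  obtain ⟨i, hi⟩ := hne
  refine ⟨a i, hi, fun y => ?_⟩
  have h0 := eq_zero_of_forall_sum_mul_mul_eq_zero b.linearIndependent Finset.univ
    (fun i => a i * y - σ y * a i) (fun x => ?_) i (Finset.mem_univ i)
  · exact sub_eq_zero.mp h0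
  have h1 := hax (y * x)
  rw [map_mul, ← hax x, Finset.mul_sum, ← sub_eq_zero, ← Finset.sum_sub_distrib] at h1
  rw [← h1]
  refine Finset.sum_congr rfl fun i _ => ?_
  noncomm_ring

/-- Two subgroups whose commutators are central scalars in a domain `K`: the kernels of the
commutator pairing have comparable indices. -/
theorem relIndex_centralizer_le {G R K : Type*} [Group G] [Ring R] [CommRing K] [IsDomain K]
    (f : G →* R) (hf : Function.Injective f) (j : K →+* R) (hj : Function.Injective j)
    (A B : Subgroup G) (hAB : ∀ a ∈ A, ∀ b ∈ B, ∃ k, j k = f (a * b * a⁻¹ * b⁻¹))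
    (hB : ∀ b ∈ B, ∀ k, f b * j k = j k * f b)
    (hfin : (Subgroup.centralizer (A : Set G)).relIndex B ≠ 0) :
    (Subgroup.centralizer (B : Set G)).relIndex A ≤
      (Subgroup.centralizer (A : Set G)).relIndex B := by
  classical
  choose! k hk using hAB
  let β : A → B →* K := fun a =>
    { toFun := fun b => k a b
      map_one' := hj <| by rw [Subgroup.coe_one, hk _ a.2 _ B.one_mem]; simp
      map_mul' := fun b b' => hj <| by
        rw [map_mul j, Subgroup.coe_mul, hk _ a.2 _ (B.mul_mem b.2 b'.2), hk _ a.2 _ b.2]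
        have h1 : ∀ x y z : G, x * (y * z) * x⁻¹ * (y * z)⁻¹ =
          (x * y * x⁻¹ * y⁻¹) * (y * (x * z * x⁻¹ * z⁻¹) * y⁻¹) := fun x y z => by group
        have h2 : f (b * (a * b' * (a : G)⁻¹ * (b' : G)⁻¹) * (b : G)⁻¹) = j (k a b') := by
          rw [map_mul, map_mul, ← hk _ a.2 _ b'.2, hB _ b.2, mul_assoc, ← map_mul, mul_inv_cancel,
            map_one, mul_one]
        rw [h1, map_mul, h2] }
  have hβ : ∀ (a : A) (b : B), j (β a b) = f (a * b * (a : G)⁻¹ * (b : G)⁻¹) :=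
    fun a b => hk _ a.2 _ b.2
  set NA := (Subgroup.centralizer (B : Set G)).subgroupOf A with hNA
  set NB := (Subgroup.centralizer (A : Set G)).subgroupOf B with hNB
  have hinj : ∀ a a' : A, β a = β a' → a⁻¹ * a' ∈ NA := by
    intro a a' h
    rw [hNA, Subgroup.mem_subgroupOf, Subgroup.mem_centralizer_iff]
    intro b hb
    have h1 := congrArg j (DFunLike.congr_fun h ⟨b, hb⟩)
    rw [hβ, hβ] at h1
    have h2 : (a * b * (a : G)⁻¹ : G) = a' * b * (a' : G)⁻¹ := mul_right_cancel (hf h1)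
    simp only [Subgroup.coe_mul, Subgroup.coe_inv]
    calc b * ((a : G)⁻¹ * a') = (a : G)⁻¹ * (a * b * (a : G)⁻¹) * a' := by group
      _ = _ := by rw [h2]; group
  have hinv : ∀ (a : A) (b n : B), n ∈ NB → β a (b * n) = β a b := by
    intro a b n hn
    rw [hNB, Subgroup.mem_subgroupOf, Subgroup.mem_centralizer_iff] at hn
    have h1 := hn a a.2
    have : β a n = 1 := hj <| by rw [hβ, h1]; simp
    rw [map_mul, this, mul_one]
  have : Finite (B ⧸ NB) := @Subgroup.finite_quotient_of_finiteIndex _ _ _ ⟨hfin⟩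
  cases nonempty_fintype (B ⧸ NB)
  have hli : LinearIndependent K (fun (q : A ⧸ NA) (p : B ⧸ NB) => β q.out p.out) := by
    have h1 := (linearIndependent_monoidHom B K).comp (fun q : A ⧸ NA => β q.out) (by
      intro q q' h
      have := QuotientGroup.eq.mpr (hinj _ _ h)
      simpa using this)
    refine LinearIndependent.of_comp (LinearMap.funLeft K K (QuotientGroup.mk : B → B ⧸ NB)) ?_
    convert h1 using 1
    funext q b
    simp only [Function.comp, LinearMap.funLeft_apply]
    have h2 : b⁻¹ * (QuotientGroup.mk b : B ⧸ NB).out ∈ NB := by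
      rw [← QuotientGroup.eq]; simp
    have h3 := hinv q.out b _ h2
    simpa using h3
  have hfA : Finite (A ⧸ NA) := hli.finite
  cases nonempty_fintype (A ⧸ NA)
  have := hli.fintype_card_le_finrank
  rw [Module.finrank_fintype_fun_eq_card] at this
  rw [Subgroup.relIndex, Subgroup.relIndex, Subgroup.index, Subgroup.index,
    Nat.card_eq_fintype_card, Nat.card_eq_fintype_card]
  exact this

section Graded

variable {Γ : Type*} [AddCommGroup Γ] [DecidableEq Γ] {D : Type*} [Ring D]
  (𝒜 : Γ → AddSubgroup D) [GradedRing 𝒜]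

theorem coe_decompose_of_mem {x : D} {γ : Γ} (hx : x ∈ 𝒜 γ) (δ : Γ) :
    (DirectSum.decompose 𝒜 x δ : D) = if γ = δ then x else 0 := by
  split_ifs with h
  · subst h
    exact DirectSum.decompose_of_mem_same 𝒜 hx
  · exact DirectSum.decompose_of_mem_ne 𝒜 hx h

theorem mem_of_forall_decompose_mem (S : AddSubgroup D) {x : D}
    (h : ∀ γ, (DirectSum.decompose 𝒜 x γ : D) ∈ S) : x ∈ S := by
  classical
  rw [← DirectSum.sum_support_decompose 𝒜 x]
  exact S.sum_mem fun γ _ => h γ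

theorem inv_mem_of_mem {u : Dˣ} {γ : Γ} (hu : (u : D) ∈ 𝒜 γ) : ((u⁻¹ : Dˣ) : D) ∈ 𝒜 (-γ) := by
  have h := DirectSum.coe_decompose_mul_add_of_left_mem 𝒜 (j := -γ) (b := ((u⁻¹ : Dˣ) : D)) hu
  rw [Units.mul_inv, add_neg_cancel,
    DirectSum.decompose_of_mem_same 𝒜 (SetLike.one_mem_graded 𝒜)] at h
  rw [Units.inv_eq_of_mul_eq_one_right h.symm]
  exact SetLike.coe_mem _

/-- The group of homogeneous units of a graded ring. -/
def homogUnits : Subgroup Dˣ where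
  carrier := {u | ∃ γ, (u : D) ∈ 𝒜 γ}
  one_mem' := ⟨0, SetLike.one_mem_graded 𝒜⟩
  mul_mem' := fun ⟨γ, hγ⟩ ⟨δ, hδ⟩ => ⟨γ + δ, SetLike.mul_mem_graded hγ hδ⟩
  inv_mem' := fun ⟨γ, hγ⟩ => ⟨-γ, inv_mem_of_mem 𝒜 hγ⟩

/-- The underlying ring element of a homogeneous unit. -/
def unitVal : homogUnits 𝒜 →* D := (Units.coeHom D).comp (homogUnits 𝒜).subtype

theorem unitVal_injective : Function.Injective (unitVal 𝒜) := fun _ _ h =>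
  Subtype.ext (Units.ext h)

theorem unitVal_mul_inv (g : homogUnits 𝒜) : unitVal 𝒜 g * unitVal 𝒜 g⁻¹ = 1 := by
  rw [← map_mul, mul_inv_cancel, map_one]

theorem unitVal_inv_mul (g : homogUnits 𝒜) : unitVal 𝒜 g⁻¹ * unitVal 𝒜 g = 1 := by
  rw [← map_mul, inv_mul_cancel, map_one]

theorem isUnit_unitVal (g : homogUnits 𝒜) : IsUnit (unitVal 𝒜 g) := ⟨g.1, rfl⟩

theorem unitVal_inv_mul_eq_mul_inv {g : homogUnits 𝒜} {x : D}
    (h : unitVal 𝒜 g * x = x * unitVal 𝒜 g) : unitVal 𝒜 g⁻¹ * x = x * unitVal 𝒜 g⁻¹ :=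
  (Commute.units_inv_left (u := g.1) h).eq

/-- The homogeneous units commuting with a set. -/
def centUnits (S : Set D) : Subgroup (homogUnits 𝒜) where
  carrier := {g | ∀ x ∈ S, unitVal 𝒜 g * x = x * unitVal 𝒜 g}
  one_mem' := fun x _ => by simp
  mul_mem' := fun {a b} ha hb x hx => by
    rw [map_mul, mul_assoc, hb x hx, ← mul_assoc, ha x hx, mul_assoc]
  inv_mem' := fun {a} ha x hx => unitVal_inv_mul_eq_mul_inv 𝒜 (ha x hx)

/-- The centralizer of a set closed under homogeneous components is graded. -/
theorem isGradedSubring_centralizer (S : Set D)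
    (hS : ∀ x ∈ S, ∀ γ, (DirectSum.decompose 𝒜 x γ : D) ∈ S) :
    IsGradedSubring 𝒜 (Subring.centralizer S) := by
  intro y hy γ
  rw [Subring.mem_centralizer_iff] at hy ⊢
  have key : ∀ x ∈ S, ∀ δ, x ∈ 𝒜 δ →
      x * (DirectSum.decompose 𝒜 y γ : D) = (DirectSum.decompose 𝒜 y γ : D) * x := by
    intro x hx δ hxδ
    rw [← DirectSum.coe_decompose_mul_add_of_left_mem 𝒜 hxδ,
      ← DirectSum.coe_decompose_mul_add_of_right_mem 𝒜 hxδ, hy x hx, add_comm]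
  intro x hx
  classical
  rw [← DirectSum.sum_support_decompose 𝒜 x, Finset.sum_mul, Finset.mul_sum]
  exact Finset.sum_congr rfl fun δ _ => key _ (hS x hx δ) δ (SetLike.coe_mem _)

/-- Inverses of elements of a centralizer stay in the centralizer. -/
theorem exists_inv_mem_centralizer (S : Set D) {x : D} (hx : x ∈ Subring.centralizer S)
    (hu : IsUnit x) : ∃ y ∈ Subring.centralizer S, x * y = 1 ∧ y * x = 1 := by
  obtain ⟨u, rfl⟩ := hu
  refine ⟨((u⁻¹ : Dˣ) : D), ?_, u.mul_inv, u.inv_mul⟩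
  rw [Subring.mem_centralizer_iff] at hx ⊢
  intro g hg
  exact (Commute.units_inv_right (u := u) (hx g hg)).eq

theorem isGradedDivSubring_centralizer (hD : IsGradedDivisionRing 𝒜) (S : Set D)
    (hS : ∀ x ∈ S, ∀ γ, (DirectSum.decompose 𝒜 x γ : D) ∈ S) :
    IsGradedDivSubring 𝒜 (Subring.centralizer S) :=
  ⟨isGradedSubring_centralizer 𝒜 S hS, fun γ x hx hxγ hx0 =>
    exists_inv_mem_centralizer S hx (hD.2 γ x hxγ hx0)⟩

theorem IsGradedDivSubring.inf {𝒜 : Γ → AddSubgroup D} [GradedRing 𝒜] {A B : Subring D}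
    (hA : IsGradedDivSubring 𝒜 A) (hB : IsGradedDivSubring 𝒜 B) :
    IsGradedDivSubring 𝒜 (A ⊓ B) := by
  refine ⟨fun x hx γ => ⟨hA.1 x hx.1 γ, hB.1 x hx.2 γ⟩, fun γ x hx hxγ hx0 => ?_⟩
  obtain ⟨y, hy, h1, h2⟩ := hA.2 γ x hx.1 hxγ hx0
  obtain ⟨z, hz, h3, h4⟩ := hB.2 γ x hx.2 hxγ hx0
  have : y = z := left_inv_eq_right_inv h2 h3
  exact ⟨y, ⟨hy, this ▸ hz⟩, h1, h2⟩

theorem le_centralizer_centralizer (S : Set D) :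
    S ⊆ Subring.centralizer (Subring.centralizer S : Set D) :=
  Set.subset_centralizer_centralizer

theorem commute_of_mem_centralizer_centralizer {S : Set D}
    (hS : ∀ x ∈ S, ∀ y ∈ S, x * y = y * x) {x y : D}
    (hx : x ∈ Subring.centralizer (Subring.centralizer S : Set D))
    (hy : y ∈ Subring.centralizer (Subring.centralizer S : Set D)) : x * y = y * x := by
  rw [Subring.mem_centralizer_iff] at hx hy
  refine hy x ?_
  rw [SetLike.mem_coe, Subring.mem_centralizer_iff]
  intro s hs
  refine hx s ?_
  rw [SetLike.mem_coe, Subring.mem_centralizer_iff]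
  exact fun t ht => hS t ht s hs

theorem commute_insert {T : Subring D} (hT : ∀ x ∈ T, ∀ y ∈ T, x * y = y * x) {x : D}
    (hxT : ∀ y ∈ T, x * y = y * x) :
    ∀ a ∈ insert x (T : Set D), ∀ b ∈ insert x (T : Set D), a * b = b * a := by
  rintro a (rfl | ha) b (rfl | hb)
  · rfl
  · exact hxT b hb
  · exact (hxT a ha).symm
  · exact hT a ha b hb

/-- A maximal graded subfield of `A` contains every homogeneous element of `A` commuting
with it. -/
theorem IsMaxGradedSubfieldOf.mem_of_commute {𝒜 : Γ → AddSubgroup D} [GradedRing 𝒜]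
    (hD : IsGradedDivisionRing 𝒜) {A T : Subring D} (hA : IsGradedDivSubring 𝒜 A)
    (hT : IsMaxGradedSubfieldOf 𝒜 A T) {x : D} {γ : Γ} (hxγ : x ∈ 𝒜 γ) (hxA : x ∈ A)
    (hxT : ∀ y ∈ T, x * y = y * x) : x ∈ T := by
  obtain ⟨⟨⟨hTg, -⟩, hTc⟩, hTA, hmax⟩ := hT
  set S : Set D := insert x (T : Set D)
  have hS : ∀ y ∈ S, ∀ δ, (DirectSum.decompose 𝒜 y δ : D) ∈ S := by
    rintro y (rfl | hy) δ
    · rw [coe_decompose_of_mem 𝒜 hxγ]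
      split_ifs
      · exact Set.mem_insert _ _
      · exact Set.mem_insert_of_mem _ T.zero_mem
    · exact Set.mem_insert_of_mem _ (hTg y hy δ)
  set T' := Subring.centralizer (Subring.centralizer S : Set D) ⊓ A
  have hT' : IsGradedDivSubring 𝒜 T' := (isGradedDivSubring_centralizer 𝒜 hD _
    (isGradedSubring_centralizer 𝒜 S hS)).inf hA
  have hle : ∀ y ∈ S, y ∈ A → y ∈ T' := fun y hy hyA => ⟨le_centralizer_centralizer S hy, hyA⟩
  have := hmax T' ⟨hT', fun a ha b hb =>
    commute_of_mem_centralizer_centralizer (commute_insert hTc hxT) ha.1 hb.1⟩ inf_le_right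
    fun y hy => hle y (Set.mem_insert_of_mem _ hy) (hTA hy)
  rw [← this]
  exact hle x (Set.mem_insert _ _) hxA

theorem mem_grade0 {x : D} : x ∈ grade0 𝒜 ↔ x ∈ 𝒜 0 := Iff.rfl

theorem isGradedDivSubring_top (hD : IsGradedDivisionRing 𝒜) : IsGradedDivSubring 𝒜 ⊤ :=
  ⟨fun _ _ _ => Subring.mem_top _, fun γ x _ hxγ hx0 => by
    obtain ⟨u, rfl⟩ := hD.2 γ x hxγ hx0
    exact ⟨((u⁻¹ : Dˣ) : D), Subring.mem_top _, u.mul_inv, u.inv_mul⟩⟩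

theorem exists_inv_mem_grade0 (hD : IsGradedDivisionRing 𝒜) {x : D} (hx : x ∈ grade0 𝒜)
    (hx0 : x ≠ 0) : ∃ y ∈ grade0 𝒜, x * y = 1 ∧ y * x = 1 := by
  obtain ⟨u, rfl⟩ := hD.2 0 x hx hx0
  refine ⟨((u⁻¹ : Dˣ) : D), ?_, u.mul_inv, u.inv_mul⟩
  have := inv_mem_of_mem 𝒜 hx
  rwa [neg_zero] at this

/-- A subfield of `D₀` is maximal iff it contains its centralizer in `D₀`. -/
theorem isMaxSubfieldOf_grade0_iff (hD : IsGradedDivisionRing 𝒜) {T : Subring D}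
    (hT : IsSubfieldOf (grade0 𝒜) T) :
    IsMaxSubfieldOf (grade0 𝒜) T ↔ ∀ x ∈ grade0 𝒜, (∀ y ∈ T, x * y = y * x) → x ∈ T := by
  constructor
  · intro h x hx hxT
    set S : Set D := insert x (T : Set D)
    set T' := Subring.centralizer (Subring.centralizer S : Set D) ⊓ grade0 𝒜
    have hle : ∀ y ∈ S, y ∈ grade0 𝒜 → y ∈ T' :=
      fun y hy hyA => ⟨le_centralizer_centralizer S hy, hyA⟩
    have := h.2 T' ⟨inf_le_right, fun a ha b hb =>
      commute_of_mem_centralizer_centralizer (commute_insert hT.2.1 hxT) ha.1 hb.1, ?_⟩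
      fun y hy => hle y (Set.mem_insert_of_mem _ hy) (hT.1 hy)
    · rw [← this]
      exact hle x (Set.mem_insert _ _) hx
    · intro a ha ha0
      obtain ⟨y, hy, h1, h2⟩ := exists_inv_mem_grade0 𝒜 hD ha.2 ha0
      obtain ⟨z, hz, h3, h4⟩ := exists_inv_mem_centralizer _ ha.1 (hD.2 0 a ha.2 ha0)
      have : y = z := left_inv_eq_right_inv h2 h3
      exact ⟨y, ⟨this ▸ hz, hy⟩, h1, h2⟩
  · refine fun h => ⟨hT, fun K' hK' hle => le_antisymm (fun x hx => ?_) hle⟩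
    exact h x (hK'.1 hx) fun y hy => hK'.2.1 x hx y (hle hy)

theorem isGradedDivSubring_center (hD : IsGradedDivisionRing 𝒜) :
    IsGradedDivSubring 𝒜 (Subring.center D) := by
  rw [← Subring.centralizer_univ]
  exact isGradedDivSubring_centralizer 𝒜 hD _ fun _ _ _ => Set.mem_univ _

theorem isGradedSubring_grade0 : IsGradedSubring 𝒜 (grade0 𝒜) := by
  intro x hx γ
  rw [coe_decompose_of_mem 𝒜 hx]
  split_ifs
  · exact hx
  · exact zero_mem _

theorem mem_center_of_forall_homog {x : D} (h : ∀ γ, ∀ y ∈ 𝒜 γ, y * x = x * y) :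
    x ∈ Subring.center D := by
  rw [Subring.mem_center_iff]
  intro y
  classical
  rw [← DirectSum.sum_support_decompose 𝒜 y, Finset.sum_mul, Finset.mul_sum]
  exact Finset.sum_congr rfl fun δ _ => h δ _ (SetLike.coe_mem _)

section Degree

variable [Nontrivial D]

/-- The degree of a homogeneous unit. -/
def udeg : homogUnits 𝒜 →* Multiplicative Γ where
  toFun g := Multiplicative.ofAdd g.2.choose
  map_one' := congrArg Multiplicative.ofAdd <| DirectSum.degree_eq_of_mem_mem 𝒜
    (Subtype.prop (1 : homogUnits 𝒜)).choose_spec (SetLike.one_mem_graded 𝒜) one_ne_zero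
  map_mul' g h := congrArg Multiplicative.ofAdd <| DirectSum.degree_eq_of_mem_mem 𝒜
    (g * h).2.choose_spec (SetLike.mul_mem_graded g.2.choose_spec h.2.choose_spec)
    (g * h).1.ne_zero

theorem unitVal_mem (g : homogUnits 𝒜) : unitVal 𝒜 g ∈ 𝒜 (udeg 𝒜 g).toAdd := g.2.choose_spec

theorem unitVal_ne_zero (g : homogUnits 𝒜) : unitVal 𝒜 g ≠ 0 := g.1.ne_zero

variable {𝒜} in
theorem udeg_eq {g : homogUnits 𝒜} {γ : Γ} (h : unitVal 𝒜 g ∈ 𝒜 γ) :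
    udeg 𝒜 g = Multiplicative.ofAdd γ :=
  congrArg Multiplicative.ofAdd <|
    DirectSum.degree_eq_of_mem_mem 𝒜 (unitVal_mem 𝒜 g) h (unitVal_ne_zero 𝒜 g)

theorem exists_unitVal_eq (hD : IsGradedDivisionRing 𝒜) {x : D} {γ : Γ} (hx : x ∈ 𝒜 γ)
    (hx0 : x ≠ 0) : ∃ g, unitVal 𝒜 g = x ∧ udeg 𝒜 g = Multiplicative.ofAdd γ := by
  obtain ⟨u, rfl⟩ := hD.2 γ x hx hx0
  exact ⟨⟨u, γ, hx⟩, rfl, udeg_eq hx⟩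

theorem unitVal_mem_grade0 {g : homogUnits 𝒜} (h : udeg 𝒜 g = 1) : unitVal 𝒜 g ∈ grade0 𝒜 := by
  have := unitVal_mem 𝒜 g
  rwa [h] at this

/-- The grade group of a graded division subring. -/
def gradeGroup (hD : IsGradedDivisionRing 𝒜) {E : Subring D} (hE : IsGradedDivSubring 𝒜 E) :
    Subgroup (Multiplicative Γ) where
  carrier := {γ | γ.toAdd ∈ gradeSet 𝒜 E}
  one_mem' := ⟨1, E.one_mem, SetLike.one_mem_graded 𝒜, one_ne_zero⟩
  mul_mem' := by
    rintro γ δ ⟨x, hx, hxγ, hx0⟩ ⟨y, hy, hyδ, hy0⟩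
    refine ⟨x * y, E.mul_mem hx hy, SetLike.mul_mem_graded hxγ hyδ, ?_⟩
    exact ((hD.2 _ x hxγ hx0).mul (hD.2 _ y hyδ hy0)).ne_zero
  inv_mem' := by
    rintro γ ⟨x, hx, hxγ, hx0⟩
    obtain ⟨y, hy, h1, h2⟩ := hE.2 _ x hx hxγ hx0
    let u : Dˣ := ⟨x, y, h1, h2⟩
    exact ⟨y, hy, inv_mem_of_mem 𝒜 (u := u) hxγ, (u⁻¹).ne_zero⟩

theorem mem_gradeGroup_iff (hD : IsGradedDivisionRing 𝒜) {E : Subring D}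
    (hE : IsGradedDivSubring 𝒜 E) {γ : Multiplicative Γ} :
    γ ∈ gradeGroup 𝒜 hD hE ↔ ∃ g, unitVal 𝒜 g ∈ E ∧ udeg 𝒜 g = γ := by
  constructor
  · rintro ⟨x, hx, hxγ, hx0⟩
    obtain ⟨g, rfl, hg⟩ := exists_unitVal_eq 𝒜 hD hxγ hx0
    exact ⟨g, hx, hg⟩
  · rintro ⟨g, hg, rfl⟩
    exact ⟨_, hg, unitVal_mem 𝒜 g, unitVal_ne_zero 𝒜 g⟩

end Degree

/-- The elements all of whose nonzero components have degree in `S`. -/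
def supportedIn (S : Subgroup (Multiplicative Γ)) : Subring D where
  carrier := {x | ∀ γ, Multiplicative.ofAdd γ ∉ S → (DirectSum.decompose 𝒜 x γ : D) = 0}
  zero_mem' := fun γ _ => by simp
  one_mem' := fun γ hγ => by
    rw [coe_decompose_of_mem 𝒜 (SetLike.one_mem_graded 𝒜), if_neg]
    rintro rfl
    exact hγ S.one_mem
  add_mem' := fun hx hy γ hγ => by simp [DirectSum.decompose_add, hx γ hγ, hy γ hγ]
  neg_mem' := fun hx γ hγ => by
    rw [← GradedRing.proj_apply, map_neg, GradedRing.proj_apply, hx γ hγ, neg_zero]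
  mul_mem' := fun {x y} hx hy γ hγ => by
    classical
    rw [DirectSum.decompose_mul, DirectSum.coe_mul_apply]
    refine Finset.sum_eq_zero fun p hp => ?_
    by_cases h1 : Multiplicative.ofAdd p.1 ∈ S
    · by_cases h2 : Multiplicative.ofAdd p.2 ∈ S
      · rw [Finset.mem_filter] at hp
        exact absurd (hp.2 ▸ S.mul_mem h1 h2) hγ
      · rw [hy _ h2, mul_zero]
    · rw [hx _ h1, zero_mul]

theorem mem_supportedIn_of_mem {S : Subgroup (Multiplicative Γ)} {x : D} {γ : Γ}
    (hx : x ∈ 𝒜 γ) (hγ : Multiplicative.ofAdd γ ∈ S) : x ∈ supportedIn 𝒜 S := by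
  intro δ hδ
  rw [coe_decompose_of_mem 𝒜 hx, if_neg]
  rintro rfl
  exact hδ hγ

/-- Homogeneous units in distinct classes modulo `S` are linearly independent over the elements
supported in `S`. -/
theorem eq_zero_of_sum_mul_unitVal_eq_zero [Nontrivial D] (S : Subgroup (Multiplicative Γ))
    {ι : Type*} (x : ι → homogUnits 𝒜)
    (hx : ∀ i j, udeg 𝒜 (x j * (x i)⁻¹) ∈ S → i = j) (s : Finset ι) (r : ι → D)
    (hr : ∀ i ∈ s, r i ∈ supportedIn 𝒜 S) (h : ∑ i ∈ s, r i * unitVal 𝒜 (x i) = 0) :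
    ∀ i ∈ s, r i = 0 := by
  intro j hj
  have key : ∀ γ, (DirectSum.decompose 𝒜 (r j) γ : D) = 0 := by
    intro γ
    by_cases hγ : Multiplicative.ofAdd γ ∈ S
    · have h1 := congrArg (GradedRing.proj 𝒜 (γ + (udeg 𝒜 (x j)).toAdd)) h
      simp only [map_sum, map_zero, GradedRing.proj_apply] at h1
      rw [Finset.sum_eq_single j] at h1
      · rw [DirectSum.coe_decompose_mul_add_of_right_mem 𝒜 (unitVal_mem 𝒜 (x j))] at h1
        exact (isUnit_unitVal 𝒜 (x j)).mul_left_eq_zero.mp h1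
      · intro i hi hij
        have : γ + (udeg 𝒜 (x j)).toAdd =
            (γ + (udeg 𝒜 (x j * (x i)⁻¹)).toAdd) + (udeg 𝒜 (x i)).toAdd := by
          rw [map_mul, map_inv, toAdd_mul, toAdd_inv]
          abel
        rw [this, DirectSum.coe_decompose_mul_add_of_right_mem 𝒜 (unitVal_mem 𝒜 (x i)),
          hr i hi, zero_mul]
        intro h2
        refine hij (hx i j ?_)
        exact (S.mul_mem_cancel_left hγ).mp h2
      · exact fun h => absurd hj h
    · exact hr j hj γ hγ
  have := mem_of_forall_decompose_mem 𝒜 ⊥ fun γ => (AddSubgroup.mem_bot.mpr (key γ))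
  exact AddSubgroup.mem_bot.mp this

/-- The center of `D₀`, as a subring of `D`. -/
def cen0 : Subring D := Subring.centralizer (grade0 𝒜 : Set D) ⊓ grade0 𝒜

theorem mem_cen0 {x : D} : x ∈ cen0 𝒜 ↔ (∀ y ∈ grade0 𝒜, y * x = x * y) ∧ x ∈ grade0 𝒜 :=
  Iff.rfl

instance instCommRingCen0 : CommRing (cen0 𝒜) :=
  { (inferInstance : Ring (cen0 𝒜)) with
    mul_comm := fun a b => Subtype.ext (((mem_cen0 𝒜).mp b.2).1 a ((mem_cen0 𝒜).mp a.2).2) }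

variable {𝒜} in
theorem isUnit_or_eq_zero_cen0 (hD : IsGradedDivisionRing 𝒜) (a : cen0 𝒜) :
    IsUnit a ∨ a = 0 := by
  by_cases h : (a : D) = 0
  · exact Or.inr (Subtype.ext h)
  · obtain ⟨y, hy, h1, h2⟩ := exists_inv_mem_grade0 𝒜 hD a.2.2 h
    obtain ⟨z, hz, h3, h4⟩ := exists_inv_mem_centralizer _ a.2.1 (hD.2 0 a a.2.2 h)
    have : y = z := left_inv_eq_right_inv h2 h3
    exact Or.inl (IsUnit.of_mul_eq_one ⟨y, ⟨this ▸ hz, hy⟩⟩ (Subtype.ext h1))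

variable {𝒜} in
theorem isDomain_cen0 [Nontrivial D] (hD : IsGradedDivisionRing 𝒜) : IsDomain (cen0 𝒜) :=
  letI := Field.ofIsUnitOrEqZero (isUnit_or_eq_zero_cen0 hD)
  inferInstance

variable {𝒜} in
theorem isUnit_or_eq_zero_grade0 (hD : IsGradedDivisionRing 𝒜) (a : grade0 𝒜) :
    IsUnit a ∨ a = 0 := by
  by_cases h : (a : D) = 0
  · exact Or.inr (Subtype.ext h)
  · obtain ⟨y, hy, h1, h2⟩ := exists_inv_mem_grade0 𝒜 hD a.2 h
    exact Or.inl ⟨⟨a, ⟨y, hy⟩, Subtype.ext h1, Subtype.ext h2⟩, rfl⟩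

instance instAlgebraCen0 : Algebra (cen0 𝒜) (grade0 𝒜) :=
  RingHom.toAlgebra' (Subring.inclusion (inf_le_right : cen0 𝒜 ≤ grade0 𝒜)) fun c x =>
    Subtype.ext (((mem_cen0 𝒜).mp c.2).1 x x.2).symm

theorem coe_smul_cen0 (c : cen0 𝒜) (x : grade0 𝒜) : ((c • x : grade0 𝒜) : D) = c * x := rfl

theorem coe_algebraMap_cen0 (c : cen0 𝒜) :
    ((algebraMap (cen0 𝒜) (grade0 𝒜) c : grade0 𝒜) : D) = c :=
  rfl

theorem mem_cen0_of_mem_center {x : D} (hx : x ∈ Subring.center D) (h0 : x ∈ grade0 𝒜) :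
    x ∈ cen0 𝒜 :=
  (mem_cen0 𝒜).mpr ⟨fun y _ => Subring.mem_center_iff.mp hx y, h0⟩

variable {𝒜} in
theorem linearIndependent_center_of_cen0 [Nontrivial D] (hD : IsGradedDivisionRing 𝒜)
    {ι : Type*} {b : ι → grade0 𝒜} (hb : LinearIndependent (cen0 𝒜) b) :
    LinearIndependent (Subring.center D) (fun i => (b i : D)) := by
  rw [linearIndependent_iff'] at hb ⊢
  intro s f hf i hi
  have hcomp : ∀ δ, ∑ i ∈ s, (DirectSum.decompose 𝒜 (f i : D) δ : D) * b i = 0 := by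
    intro δ
    have h1 := congrArg (GradedRing.proj 𝒜 (δ + 0)) hf
    simp only [map_sum, map_zero, GradedRing.proj_apply, Subring.smul_def, smul_eq_mul] at h1
    rw [← h1]
    refine Finset.sum_congr rfl fun i _ => ?_
    rw [DirectSum.coe_decompose_mul_add_of_right_mem 𝒜 (b i).2]
  have key : ∀ δ, (DirectSum.decompose 𝒜 (f i : D) δ : D) = 0 := by
    intro δ
    by_contra hne
    obtain ⟨g, hg, hgδ⟩ := exists_unitVal_eq 𝒜 hD (SetLike.coe_mem _) hne
    have hcen : ∀ j, (DirectSum.decompose 𝒜 (f j : D) δ : D) ∈ Subring.center D := fun j =>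
      (isGradedDivSubring_center 𝒜 hD).1 _ (f j).2 δ
    have hginv : unitVal 𝒜 g⁻¹ ∈ Subring.center D := by
      rw [Subring.mem_center_iff]
      intro y
      refine (unitVal_inv_mul_eq_mul_inv 𝒜 ?_).symm
      rw [hg]
      exact (Subring.mem_center_iff.mp (hcen i) y).symm
    have h0 : ∀ j, unitVal 𝒜 g⁻¹ * (DirectSum.decompose 𝒜 (f j : D) δ : D) ∈ grade0 𝒜 := by
      intro j
      have h1 := SetLike.mul_mem_graded (unitVal_mem 𝒜 g⁻¹)
        (SetLike.coe_mem (DirectSum.decompose 𝒜 (f j : D) δ))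
      rw [map_inv, hgδ, toAdd_inv, toAdd_ofAdd, neg_add_cancel] at h1
      exact h1
    have := hb s (fun j => ⟨_, mem_cen0_of_mem_center 𝒜
      (Subring.mul_mem _ hginv (hcen j)) (h0 j)⟩) (Subtype.ext ?_) i hi
    · have h2 := congrArg Subtype.val this
      simp only [← hg, unitVal_inv_mul] at h2
      exact one_ne_zero h2
    · have h2 := congrArg (unitVal 𝒜 g⁻¹ * ·) (hcomp δ)
      simp only [Finset.mul_sum, mul_zero, ← mul_assoc] at h2
      simpa only [AddSubmonoidClass.coe_finsetSum, coe_smul_cen0, ZeroMemClass.coe_zero] using h2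
  exact Subtype.ext (AddSubgroup.mem_bot.mp
    (mem_of_forall_decompose_mem 𝒜 ⊥ fun γ => AddSubgroup.mem_bot.mpr (key γ)))

variable {𝒜} in
theorem finite_cen0_grade0 [Nontrivial D] (hD : IsGradedDivisionRing 𝒜)
    (hfin : Module.Finite (Subring.center D) D) : Module.Finite (cen0 𝒜) (grade0 𝒜) := by
  let _ := Field.ofIsUnitOrEqZero (isUnit_or_eq_zero_cen0 hD)
  let b := Module.Basis.ofVectorSpace (cen0 𝒜) (grade0 𝒜)
  have := (linearIndependent_center_of_cen0 hD b.linearIndependent).finite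
  exact Module.Finite.of_basis b

/-- Conjugation by a homogeneous unit, on `D₀`. -/
theorem conj_mem_grade0 [Nontrivial D] (g : homogUnits 𝒜) {x : D} (hx : x ∈ grade0 𝒜) :
    unitVal 𝒜 g * x * unitVal 𝒜 g⁻¹ ∈ grade0 𝒜 := by
  have h1 := SetLike.mul_mem_graded (SetLike.mul_mem_graded (unitVal_mem 𝒜 g) hx)
    (unitVal_mem 𝒜 g⁻¹)
  rw [map_inv, toAdd_inv, add_zero, add_neg_cancel] at h1
  exact h1

variable {𝒜} in
/-- Every degree in which `D` commutes with `Z(D₀)` contains a unit commuting with `D₀`. -/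
theorem exists_mem_centUnits_grade0 [Nontrivial D] (hD : IsGradedDivisionRing 𝒜)
    (hfin : Module.Finite (Subring.center D) D) {g : homogUnits 𝒜}
    (hg : g ∈ centUnits 𝒜 (cen0 𝒜 : Set D)) :
    ∃ c ∈ centUnits 𝒜 (grade0 𝒜 : Set D), udeg 𝒜 c = udeg 𝒜 g := by
  have hfin0 := finite_cen0_grade0 hD hfin
  let _ := Field.ofIsUnitOrEqZero (isUnit_or_eq_zero_cen0 hD)
  let _ := DivisionRing.ofIsUnitOrEqZero (isUnit_or_eq_zero_grade0 hD)
  have hcentral : Algebra.IsCentral (cen0 𝒜) (grade0 𝒜) := ⟨fun x hx => by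
    rw [Subalgebra.mem_center_iff] at hx
    exact Algebra.mem_bot.mpr ⟨⟨x, (mem_cen0 𝒜).mpr
      ⟨fun y hy => congrArg Subtype.val (hx ⟨y, hy⟩), x.2⟩⟩, rfl⟩⟩
  let σ : grade0 𝒜 →ₐ[cen0 𝒜] grade0 𝒜 :=
    { toFun := fun x => ⟨_, conj_mem_grade0 𝒜 g x.2⟩
      map_one' := Subtype.ext <| by simp [unitVal_mul_inv]
      map_zero' := Subtype.ext <| by simp
      map_mul' := fun x y => Subtype.ext <| by
        simp only [Subring.coe_mul]
        calc _ = unitVal 𝒜 g * x * 1 * y * unitVal 𝒜 g⁻¹ := by simp only [mul_one, mul_assoc]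
          _ = _ := by rw [← unitVal_inv_mul 𝒜 g]; simp only [mul_assoc]
      map_add' := fun x y => Subtype.ext <| by
        simp only [Subring.coe_add, mul_add, add_mul]
      commutes' := fun k => Subtype.ext <| by
        simp only [coe_algebraMap_cen0]
        rw [hg k k.2, mul_assoc, unitVal_mul_inv, mul_one] }
  obtain ⟨a, ha0, ha⟩ := exists_ne_zero_mul_eq_map_mul σ
  obtain ⟨u, hu, hu0⟩ := exists_unitVal_eq 𝒜 hD a.2 (fun h => ha0 (Subtype.ext h))
  refine ⟨(g⁻¹ * u)⁻¹, Subgroup.inv_mem _ fun y hy => ?_, by simp [hu0]⟩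
  have h1 : (a : D) * y = unitVal 𝒜 g * y * unitVal 𝒜 g⁻¹ * a :=
    congrArg Subtype.val (ha ⟨y, hy⟩)
  rw [map_mul, hu, mul_assoc, h1]
  simp only [← mul_assoc]
  rw [unitVal_inv_mul, one_mul]

variable {𝒜} in
/-- Modulo the degrees of the center there are finitely many degrees. -/
theorem index_comap_gradeGroup_center_ne_zero [Nontrivial D] (hD : IsGradedDivisionRing 𝒜)
    (hfin : Module.Finite (Subring.center D) D) :
    ((gradeGroup 𝒜 hD (isGradedDivSubring_center 𝒜 hD)).comap (udeg 𝒜)).index ≠ 0 := by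
  set S := gradeGroup 𝒜 hD (isGradedDivSubring_center 𝒜 hD)
  have hli : LinearIndependent (Subring.center D)
      (fun q : homogUnits 𝒜 ⧸ S.comap (udeg 𝒜) => unitVal 𝒜 q.out) := by
    rw [linearIndependent_iff']
    intro s r hr i hi
    refine Subtype.ext (eq_zero_of_sum_mul_unitVal_eq_zero 𝒜 S
      (fun q : homogUnits 𝒜 ⧸ S.comap (udeg 𝒜) => q.out) ?_ s (fun i => (r i : D)) ?_ hr i hi)
    · intro i j hij
      rw [← QuotientGroup.out_eq' i, ← QuotientGroup.out_eq' j, QuotientGroup.eq,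
        Subgroup.mem_comap]
      rwa [map_mul, mul_comm, ← map_mul] at hij
    · intro i _ γ hγ
      by_contra h
      exact hγ ⟨_, (isGradedDivSubring_center 𝒜 hD).1 _ (r i).2 γ, SetLike.coe_mem _, h⟩
  have := hli.finite
  exact Subgroup.index_ne_zero_of_finite

theorem conj_mem_centralizer_grade0 [Nontrivial D] (g : homogUnits 𝒜) {x : D}
    (hx : x ∈ Subring.centralizer (grade0 𝒜 : Set D)) :
    unitVal 𝒜 g * x * unitVal 𝒜 g⁻¹ ∈ Subring.centralizer (grade0 𝒜 : Set D) := by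
  rw [Subring.mem_centralizer_iff] at hx ⊢
  intro y hy
  have h1 := hx _ (conj_mem_grade0 𝒜 g⁻¹ hy)
  rw [inv_inv] at h1
  have h2 := congrArg (fun d => unitVal 𝒜 g * d * unitVal 𝒜 g⁻¹) h1
  simp only [← mul_assoc, unitVal_mul_inv, one_mul] at h2
  rw [← mul_assoc, ← mul_assoc, h2, mul_assoc _ (unitVal 𝒜 g) (unitVal 𝒜 g⁻¹), unitVal_mul_inv,
    mul_one]

theorem unitVal_mem_centralizer_iff {g : homogUnits 𝒜} {S : Set D} :
    unitVal 𝒜 g ∈ Subring.centralizer S ↔ g ∈ centUnits 𝒜 S := by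
  rw [Subring.mem_centralizer_iff]
  exact forall₂_congr fun _ _ => eq_comm

theorem unitVal_mem_cen0 [Nontrivial D] {g : homogUnits 𝒜}
    (hg : g ∈ centUnits 𝒜 (grade0 𝒜 : Set D)) (h1 : udeg 𝒜 g = 1) : unitVal 𝒜 g ∈ cen0 𝒜 :=
  ⟨(unitVal_mem_centralizer_iff 𝒜).mpr hg, unitVal_mem_grade0 𝒜 h1⟩

theorem conj_mem_centUnits_grade0 [Nontrivial D] (g : homogUnits 𝒜) {c : homogUnits 𝒜}
    (hc : c ∈ centUnits 𝒜 (grade0 𝒜 : Set D)) :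
    g * c * g⁻¹ ∈ centUnits 𝒜 (grade0 𝒜 : Set D) := by
  rw [← unitVal_mem_centralizer_iff] at hc ⊢
  rw [map_mul, map_mul]
  exact conj_mem_centralizer_grade0 𝒜 g hc

theorem commutator_mem_cen0 [Nontrivial D] (g : homogUnits 𝒜) {c : homogUnits 𝒜}
    (hc : c ∈ centUnits 𝒜 (grade0 𝒜 : Set D)) :
    unitVal 𝒜 (g * c * g⁻¹ * c⁻¹) ∈ cen0 𝒜 := by
  refine unitVal_mem_cen0 𝒜 (mul_mem (conj_mem_centUnits_grade0 𝒜 g hc) (inv_mem hc)) ?_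
  simp

variable {𝒜} in
theorem mem_centUnits_cen0_of_udeg_mem [Nontrivial D] (hD : IsGradedDivisionRing 𝒜)
    {n : homogUnits 𝒜} (hn : udeg 𝒜 n ∈ gradeGroup 𝒜 hD (isGradedDivSubring_center 𝒜 hD)) :
    n ∈ centUnits 𝒜 (cen0 𝒜 : Set D) := by
  obtain ⟨f, hf, hfn⟩ := (mem_gradeGroup_iff 𝒜 hD _).mp hn
  have h1 : n * f⁻¹ ∈ centUnits 𝒜 (cen0 𝒜 : Set D) := fun x hx =>
    hx.1 _ (unitVal_mem_grade0 𝒜 (by rw [map_mul, map_inv, hfn, mul_inv_cancel]))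
  have h2 : f ∈ centUnits 𝒜 (cen0 𝒜 : Set D) := fun x _ =>
    (Subring.mem_center_iff.mp hf x).symm
  simpa using mul_mem h1 h2

/-- Conjugation by a homogeneous unit, on the center of `D₀`. -/
def conjCen0 [Nontrivial D] (g : homogUnits 𝒜) : cen0 𝒜 →* cen0 𝒜 where
  toFun k := ⟨unitVal 𝒜 g * k * unitVal 𝒜 g⁻¹,
    conj_mem_centralizer_grade0 𝒜 g k.2.1, conj_mem_grade0 𝒜 g k.2.2⟩
  map_one' := Subtype.ext <| by simp [unitVal_mul_inv]
  map_mul' x y := Subtype.ext <| by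
    simp only [Subring.coe_mul]
    calc _ = unitVal 𝒜 g * x * 1 * y * unitVal 𝒜 g⁻¹ := by simp only [mul_one, mul_assoc]
      _ = _ := by rw [← unitVal_inv_mul 𝒜 g]; simp only [mul_assoc]

theorem coe_conjCen0 [Nontrivial D] (g : homogUnits 𝒜) (k : cen0 𝒜) :
    (conjCen0 𝒜 g k : D) = unitVal 𝒜 g * k * unitVal 𝒜 g⁻¹ := rfl

/-- Conjugation depends only on the class modulo units commuting with the argument. -/
theorem conj_eq_conj_of_commute {g h : homogUnits 𝒜} {x : D}
    (hx : unitVal 𝒜 (g⁻¹ * h) * x = x * unitVal 𝒜 (g⁻¹ * h)) :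
    unitVal 𝒜 g * x * unitVal 𝒜 g⁻¹ = unitVal 𝒜 h * x * unitVal 𝒜 h⁻¹ := by
  have h1 : unitVal 𝒜 h = unitVal 𝒜 g * unitVal 𝒜 (g⁻¹ * h) := by
    rw [← map_mul, mul_inv_cancel_left]
  have h2 : unitVal 𝒜 (g⁻¹ * h) * unitVal 𝒜 h⁻¹ = unitVal 𝒜 g⁻¹ := by
    rw [← map_mul, mul_assoc, mul_inv_cancel, mul_one]
  rw [← h2, h1, mul_assoc (unitVal 𝒜 g), mul_assoc (unitVal 𝒜 g), mul_assoc (unitVal 𝒜 g), hx]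
  simp only [mul_assoc]

theorem conjCen0_injective_mod [Nontrivial D] {g h : homogUnits 𝒜}
    (hgh : conjCen0 𝒜 g = conjCen0 𝒜 h) : g⁻¹ * h ∈ centUnits 𝒜 (cen0 𝒜 : Set D) := by
  intro x hx
  have h1 := congrArg Subtype.val (DFunLike.congr_fun hgh ⟨x, hx⟩)
  rw [coe_conjCen0, coe_conjCen0] at h1
  have h2 := congrArg (fun d => unitVal 𝒜 g⁻¹ * d * unitVal 𝒜 h) h1
  simp only [← mul_assoc, unitVal_inv_mul, one_mul] at h2
  rw [mul_assoc _ (unitVal 𝒜 h⁻¹) (unitVal 𝒜 h), unitVal_inv_mul, mul_one] at h2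
  rw [map_mul, ← h2, mul_assoc]

variable {𝒜} in
/-- A homogeneous unit of the center of `C_D(D₀)` has the degree of a central unit of `D`. -/
theorem udeg_mem_of_mem_centralizer [Nontrivial D] (hD : IsGradedDivisionRing 𝒜)
    (hfin : Module.Finite (Subring.center D) D) {c : homogUnits 𝒜}
    (hc : c ∈ centUnits 𝒜 (grade0 𝒜 : Set D))
    (hcc : c ∈ Subgroup.centralizer (centUnits 𝒜 (grade0 𝒜 : Set D) : Set (homogUnits 𝒜))) :
    udeg 𝒜 c ∈ gradeGroup 𝒜 hD (isGradedDivSubring_center 𝒜 hD) := by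
  set E := centUnits 𝒜 (cen0 𝒜 : Set D) with hE
  have hcE : ∀ g ∈ E, g * c = c * g := by
    intro g hg
    obtain ⟨x, hx, hxg⟩ := exists_mem_centUnits_grade0 hD hfin hg
    have h1 : Commute c (g * x⁻¹) := unitVal_injective 𝒜 <| by
      have := hc (unitVal 𝒜 (g * x⁻¹))
        (unitVal_mem_grade0 𝒜 (by rw [map_mul, map_inv, hxg, mul_inv_cancel]))
      rwa [← map_mul, ← map_mul] at this
    have h2 : Commute c x := (Subgroup.mem_centralizer_iff.mp hcc x hx).symm
    simpa using (h1.mul_right h2).symm.eq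
  have hEidx : E.index ≠ 0 := fun h0 => index_comap_gradeGroup_center_ne_zero hD hfin
    (zero_dvd_iff.mp
      (h0 ▸ Subgroup.index_dvd_of_le fun n hn => mem_centUnits_cen0_of_udeg_mem hD hn))
  have hfinQ : Finite (homogUnits 𝒜 ⧸ E) := @Subgroup.finite_quotient_of_finiteIndex _ _ _ ⟨hEidx⟩
  cases nonempty_fintype (homogUnits 𝒜 ⧸ E)
  have hdom := isDomain_cen0 hD
  have hli := (linearIndependent_monoidHom (cen0 𝒜) (cen0 𝒜)).comp
    (fun q : homogUnits 𝒜 ⧸ E => conjCen0 𝒜 q.out) fun q q' h => by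
      rw [← QuotientGroup.out_eq' q, ← QuotientGroup.out_eq' q', QuotientGroup.eq]
      exact conjCen0_injective_mod 𝒜 h
  let a : homogUnits 𝒜 ⧸ E → cen0 𝒜 := fun q => ⟨_, commutator_mem_cen0 𝒜 q.out hc⟩
  obtain ⟨k, hk⟩ : ∃ k, ∑ q, a q * conjCen0 𝒜 q.out k ≠ 0 := by
    by_contra! h
    have h1 := Fintype.linearIndependent_iff.mp hli a (funext fun k => by
      simpa [Finset.sum_apply] using h k) (QuotientGroup.mk 1)
    exact unitVal_ne_zero 𝒜 _ (congrArg Subtype.val h1)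
  set z := ∑ q, a q * conjCen0 𝒜 q.out k with hz
  let T : homogUnits 𝒜 → D := fun g => unitVal 𝒜 g * (k * unitVal 𝒜 c) * unitVal 𝒜 g⁻¹
  have hTinv : ∀ g h : homogUnits 𝒜, (g : homogUnits 𝒜 ⧸ E) = h → T g = T h := by
    intro g h hgh
    rw [QuotientGroup.eq] at hgh
    refine conj_eq_conj_of_commute 𝒜 ?_
    rw [← mul_assoc, hgh k k.2, mul_assoc, ← map_mul, hcE _ hgh, map_mul, mul_assoc]
  have hsum : ∑ q : homogUnits 𝒜 ⧸ E, T q.out = z * unitVal 𝒜 c := by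
    rw [hz, AddSubmonoidClass.coe_finsetSum, Finset.sum_mul]
    refine Finset.sum_congr rfl fun q _ => ?_
    rw [mul_comm (a q), Subring.coe_mul, coe_conjCen0]
    change T q.out = unitVal 𝒜 q.out * k * unitVal 𝒜 q.out⁻¹ *
      unitVal 𝒜 (q.out * c * q.out⁻¹ * c⁻¹) * unitVal 𝒜 c
    have h1 : unitVal 𝒜 q.out⁻¹ * (unitVal 𝒜 (q.out * c * q.out⁻¹ * c⁻¹) * unitVal 𝒜 c) =
        unitVal 𝒜 c * unitVal 𝒜 q.out⁻¹ := by
      simp only [← map_mul]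
      congr 1
      group
    simp only [T]
    rw [mul_assoc _ _ (unitVal 𝒜 c), mul_assoc _ (unitVal 𝒜 q.out⁻¹), h1]
    simp only [mul_assoc]
  have hcen : (z : D) * unitVal 𝒜 c ∈ Subring.center D := by
    refine mem_center_of_forall_homog 𝒜 fun γ y hy => ?_
    by_cases hy0 : y = 0
    · simp [hy0]
    obtain ⟨h, rfl, -⟩ := exists_unitVal_eq 𝒜 hD hy hy0
    have h1 : unitVal 𝒜 h * ((z : D) * unitVal 𝒜 c) * unitVal 𝒜 h⁻¹ = z * unitVal 𝒜 c := by
      rw [← hsum, Finset.mul_sum, Finset.sum_mul,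
        ← Equiv.sum_comp (MulAction.toPerm h) (fun q : homogUnits 𝒜 ⧸ E => T q.out)]
      refine Finset.sum_congr rfl fun q _ => ?_
      refine Eq.trans ?_ (hTinv (h * q.out) (MulAction.toPerm h q).out ?_)
      · simp only [T, mul_inv_rev, map_mul, mul_assoc]
      · rw [QuotientGroup.out_eq', MulAction.toPerm_apply]
        conv_rhs => rw [← QuotientGroup.out_eq' q]
        rfl
    calc _ = unitVal 𝒜 h * ((z : D) * unitVal 𝒜 c) * (unitVal 𝒜 h⁻¹ * unitVal 𝒜 h) := by
          rw [unitVal_inv_mul, mul_one]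
      _ = _ := by rw [← mul_assoc, h1]
  refine ⟨_, hcen, ?_, fun h0 => hk (Subtype.ext ((isUnit_unitVal 𝒜 c).mul_left_eq_zero.mp h0))⟩
  have := SetLike.mul_mem_graded ((mem_grade0 𝒜).mp z.2.2) (unitVal_mem 𝒜 c)
  rwa [zero_add] at this

theorem Cc_center : Cc 𝒜 (Subring.center D) = Subring.centralizer (grade0 𝒜 : Set D) := by
  refine le_antisymm (Subring.centralizer_le _ _ (le_sup_left : grade0 𝒜 ≤ Uc 𝒜 _)) fun x hx => ?_
  have h : Uc 𝒜 (Subring.center D) ≤ Subring.centralizer {x} := by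
    refine sup_le (fun y hy => ?_) (Subring.center_le_centralizer _)
    rw [Subring.mem_centralizer_iff]
    rintro _ rfl
    exact (Subring.mem_centralizer_iff.mp hx y hy).symm
  exact Subring.mem_centralizer_iff.mpr fun y hy =>
    (Subring.mem_centralizer_iff.mp (h hy) x rfl).symm

theorem Zc_center_le_centralizer : Zc 𝒜 (Subring.center D) ≤
    Subring.centralizer (Subring.centralizer (grade0 𝒜 : Set D) : Set D) :=
  sup_le (inf_le_right.trans (le_centralizer_centralizer _)) (Subring.center_le_centralizer _)

theorem Zc_center_le_Cc : Zc 𝒜 (Subring.center D) ≤ Cc 𝒜 (Subring.center D) := by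
  rw [Cc_center]
  exact sup_le inf_le_left (Subring.center_le_centralizer _)

variable {𝒜} in
theorem Zc_center_le_supportedIn [Nontrivial D] (hD : IsGradedDivisionRing 𝒜) :
    Zc 𝒜 (Subring.center D) ≤
      supportedIn 𝒜 (gradeGroup 𝒜 hD (isGradedDivSubring_center 𝒜 hD)) := by
  refine sup_le (fun x hx => mem_supportedIn_of_mem 𝒜 hx.2 (one_mem _)) fun x hx γ hγ => ?_
  by_contra h
  exact hγ ⟨_, (isGradedDivSubring_center 𝒜 hD).1 _ hx γ, SetLike.coe_mem _, h⟩

variable {𝒜} in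
theorem gradeSet_Zc_center [Nontrivial D] (hD : IsGradedDivisionRing 𝒜) :
    gradeSet 𝒜 (Zc 𝒜 (Subring.center D)) = gradeSet 𝒜 (Subring.center D) := by
  refine Set.Subset.antisymm ?_ ?_
  · rintro γ ⟨x, hx, hxγ, hx0⟩
    by_contra h
    have h1 := Zc_center_le_supportedIn hD hx γ h
    rw [DirectSum.decompose_of_mem_same 𝒜 hxγ] at h1
    exact hx0 h1
  · rintro γ ⟨x, hx, hxγ, hx0⟩
    exact ⟨x, (le_sup_right : _ ≤ Zc 𝒜 _) hx, hxγ, hx0⟩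

variable {𝒜} in
theorem addSetIndex_gradeSet [Nontrivial D] (hD : IsGradedDivisionRing 𝒜) {A B : Subring D}
    (hA : IsGradedDivSubring 𝒜 A) (hB : IsGradedDivSubring 𝒜 B) :
    addSetIndex (gradeSet 𝒜 A) (gradeSet 𝒜 B) =
      (gradeGroup 𝒜 hD hB).relIndex (gradeGroup 𝒜 hD hA) := by
  let e : gradeSet 𝒜 A ≃ gradeGroup 𝒜 hD hA :=
    { toFun := fun x => ⟨Multiplicative.ofAdd x.1, x.2⟩
      invFun := fun x => ⟨x.1.toAdd, x.2⟩
      left_inv := fun _ => rfl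
      right_inv := fun _ => rfl }
  refine Nat.card_congr (Quot.congr e fun x y => ?_)
  rw [QuotientGroup.leftRel_apply, Subgroup.mem_subgroupOf, ← inv_mem_iff]
  change _ ↔ -(-(x : Γ) + y) ∈ gradeSet 𝒜 B
  rw [neg_add, neg_neg, ← sub_eq_add_neg]

variable {𝒜} in
theorem unitVal_mem_Zc [Nontrivial D] (hD : IsGradedDivisionRing 𝒜) {n : homogUnits 𝒜}
    (hn : n ∈ centUnits 𝒜 (grade0 𝒜 : Set D))
    (hdeg : udeg 𝒜 n ∈ gradeGroup 𝒜 hD (isGradedDivSubring_center 𝒜 hD)) :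
    unitVal 𝒜 n ∈ Zc 𝒜 (Subring.center D) := by
  obtain ⟨f, hf, hfn⟩ := (mem_gradeGroup_iff 𝒜 hD _).mp hdeg
  have hfC : f ∈ centUnits 𝒜 (grade0 𝒜 : Set D) := fun x _ =>
    (Subring.mem_center_iff.mp hf x).symm
  have h1 : unitVal 𝒜 (n * f⁻¹) ∈ cen0 𝒜 :=
    unitVal_mem_cen0 𝒜 (mul_mem hn (inv_mem hfC)) (by simp [hfn])
  have h2 := mul_mem ((le_sup_left : cen0 𝒜 ≤ Zc 𝒜 _) h1) ((le_sup_right : _ ≤ Zc 𝒜 _) hf)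
  rwa [← map_mul, inv_mul_cancel_right] at h2

variable {𝒜} in
theorem relIndex_comap_gradeGroup_center_ne_zero [Nontrivial D] (hD : IsGradedDivisionRing 𝒜)
    (hfin : Module.Finite (Subring.center D) D) (K : Subgroup (homogUnits 𝒜)) :
    ((gradeGroup 𝒜 hD (isGradedDivSubring_center 𝒜 hD)).comap (udeg 𝒜)).relIndex K ≠ 0 :=
  fun h0 => index_comap_gradeGroup_center_ne_zero hD hfin
    (zero_dvd_iff.mp (h0 ▸ Subgroup.relIndex_dvd_index_of_normal _ K))

variable {𝒜} in
/-- The rank of `𝖢` over `𝖹` is the index of their groups of degrees. -/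
theorem relDim_Zc_Cc [Nontrivial D] (hD : IsGradedDivisionRing 𝒜)
    (hfin : Module.Finite (Subring.center D) D) :
    relDim (Zc 𝒜 (Subring.center D)) (Cc 𝒜 (Subring.center D)) =
      ((gradeGroup 𝒜 hD (isGradedDivSubring_center 𝒜 hD)).comap (udeg 𝒜)).relIndex
        (centUnits 𝒜 (grade0 𝒜 : Set D)) := by
  classical
  set S := gradeGroup 𝒜 hD (isGradedDivSubring_center 𝒜 hD)
  set Cu := centUnits 𝒜 (grade0 𝒜 : Set D)
  set C := Cc 𝒜 (Subring.center D) with hC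
  have hCC : C = Subring.centralizer (grade0 𝒜 : Set D) := Cc_center 𝒜
  let R := (Zc 𝒜 (Subring.center D)).comap C.subtype
  let _ : CommRing R :=
    { (inferInstance : Ring R) with
      mul_comm := fun a b => Subtype.ext <| Subtype.ext <|
        (Subring.mem_centralizer_iff.mp (Zc_center_le_centralizer 𝒜 b.2) a.1.1
          (hCC ▸ a.1.2)) }
  have hCu : ∀ g ∈ Cu, unitVal 𝒜 g ∈ C := fun g hg =>
    hCC ▸ (unitVal_mem_centralizer_iff 𝒜).mpr hg
  let v : Cu ⧸ (S.comap (udeg 𝒜)).subgroupOf Cu → C := fun q => ⟨unitVal 𝒜 q.out, hCu _ q.out.2⟩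
  have hli : LinearIndependent R v := by
    rw [linearIndependent_iff']
    intro s r hr i hi
    refine Subtype.ext <| Subtype.ext <| eq_zero_of_sum_mul_unitVal_eq_zero 𝒜 S
      (fun q : Cu ⧸ (S.comap (udeg 𝒜)).subgroupOf Cu => (q.out : homogUnits 𝒜)) ?_ s
      (fun i => ((r i : C) : D)) ?_ ?_ i hi
    · intro i j hij
      rw [← QuotientGroup.out_eq' i, ← QuotientGroup.out_eq' j, QuotientGroup.eq,
        Subgroup.mem_subgroupOf, Subgroup.mem_comap]
      rw [map_mul, mul_comm, ← map_mul] at hij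
      exact hij
    · exact fun i _ => Zc_center_le_supportedIn hD (r i).2
    · have := congrArg Subtype.val hr
      rw [AddSubmonoidClass.coe_finsetSum] at this
      exact this
  have hspan : ⊤ ≤ Submodule.span R (Set.range v) := by
    have key : ∀ g ∈ Cu, ∀ h : unitVal 𝒜 g ∈ C,
        (⟨unitVal 𝒜 g, h⟩ : C) ∈ Submodule.span R (Set.range v) := by
      intro g hg h
      let q : Cu ⧸ (S.comap (udeg 𝒜)).subgroupOf Cu := QuotientGroup.mk ⟨g, hg⟩
      have hq : udeg 𝒜 (g * (q.out : homogUnits 𝒜)⁻¹) ∈ S := by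
        have h1 : QuotientGroup.mk q.out = q := QuotientGroup.out_eq' q
        rw [QuotientGroup.eq, Subgroup.mem_subgroupOf, Subgroup.mem_comap] at h1
        rw [map_mul, mul_comm, ← map_mul]
        exact h1
      have hz := unitVal_mem_Zc hD (mul_mem hg (inv_mem q.out.2)) hq
      have h2 : (⟨unitVal 𝒜 g, h⟩ : C) =
          (⟨⟨_, Zc_center_le_Cc 𝒜 hz⟩, hz⟩ : R) • v q := Subtype.ext <| by
        change unitVal 𝒜 g = unitVal 𝒜 _ * unitVal 𝒜 _
        rw [← map_mul, inv_mul_cancel_right]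
      rw [h2]
      exact Submodule.smul_mem _ _ (Submodule.subset_span ⟨q, rfl⟩)
    have hgr : ∀ c : C, ∀ γ, (DirectSum.decompose 𝒜 (c : D) γ : D) ∈ C := fun c γ =>
      hCC.ge (isGradedSubring_centralizer 𝒜 _ (isGradedSubring_grade0 𝒜) c (hCC.le c.2) γ)
    rintro c -
    have hc : c = ∑ γ ∈ (DirectSum.decompose 𝒜 (c : D)).support, ⟨_, hgr c γ⟩ := Subtype.ext <| by
      rw [AddSubmonoidClass.coe_finsetSum]
      exact (DirectSum.sum_support_decompose 𝒜 (c : D)).symm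
    rw [hc]
    refine Submodule.sum_mem _ fun γ hγ => ?_
    obtain ⟨g, hg, -⟩ := exists_unitVal_eq 𝒜 hD
      (SetLike.coe_mem (DirectSum.decompose 𝒜 (c : D) γ)) fun h0 =>
        DFinsupp.mem_support_iff.mp hγ (Subtype.ext h0)
    have hgC := hgr c γ
    simp only [← hg]
    refine key g ?_ _
    rw [← hg, hCC] at hgC
    exact (unitVal_mem_centralizer_iff 𝒜).mp hgC
  have hfinq : Finite (Cu ⧸ (S.comap (udeg 𝒜)).subgroupOf Cu) :=
    @Subgroup.finite_quotient_of_finiteIndex _ _ _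
      ⟨relIndex_comap_gradeGroup_center_ne_zero hD hfin Cu⟩
  have : Nontrivial R := ⟨0, 1, fun h => hD.1 (congrArg (fun r : R => ((r : C) : D)) h)⟩
  exact Module.finrank_eq_nat_card_basis (Module.Basis.mk hli hspan)

section MaxSubfield

variable {𝒜} {M : Subring D}

theorem commute_of_forall_unitVal (hD : IsGradedDivisionRing 𝒜) (hM : IsGradedSubring 𝒜 M)
    {x : D} (h : ∀ g, unitVal 𝒜 g ∈ M → x * unitVal 𝒜 g = unitVal 𝒜 g * x) :
    ∀ y ∈ M, x * y = y * x := by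
  classical
  intro y hy
  rw [← DirectSum.sum_support_decompose 𝒜 y, Finset.sum_mul, Finset.mul_sum]
  refine Finset.sum_congr rfl fun γ _ => ?_
  by_cases h0 : (DirectSum.decompose 𝒜 y γ : D) = 0
  · simp [h0]
  · obtain ⟨u, hu⟩ := hD.2 γ _ (SetLike.coe_mem _) h0
    have h1 : (u : D) ∈ 𝒜 γ := by
      rw [hu]
      exact SetLike.coe_mem _
    have h2 : (u : D) ∈ M := by
      rw [hu]
      exact hM y hy γ
    rw [← hu]
    exact h ⟨u, γ, h1⟩ h2

/-- A maximal graded subfield contains every homogeneous element commuting with its homogeneous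
units. -/
theorem IsMaxGradedSubfieldOf.mem_of_commute_unitVal (hD : IsGradedDivisionRing 𝒜)
    (hM : IsMaxGradedSubfieldOf 𝒜 ⊤ M) {x : D} {γ : Γ} (hx : x ∈ 𝒜 γ)
    (h : ∀ g, unitVal 𝒜 g ∈ M → x * unitVal 𝒜 g = unitVal 𝒜 g * x) : x ∈ M :=
  hM.mem_of_commute hD (isGradedDivSubring_top 𝒜 hD) hx (Subring.mem_top _)
    (commute_of_forall_unitVal hD hM.1.1.1 h)

theorem IsMaxGradedSubfieldOf.center_le (hD : IsGradedDivisionRing 𝒜)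
    (hM : IsMaxGradedSubfieldOf 𝒜 ⊤ M) : Subring.center D ≤ M := by
  intro x hx
  refine mem_of_forall_decompose_mem 𝒜 M.toAddSubgroup fun γ => ?_
  refine hM.mem_of_commute_unitVal hD (SetLike.coe_mem _) fun g _ => ?_
  exact (Subring.mem_center_iff.mp ((isGradedDivSubring_center 𝒜 hD).1 x hx γ) _).symm

theorem isSubfieldOf_inf_grade0 (hD : IsGradedDivisionRing 𝒜) (hM : IsGradedSubfield 𝒜 M) :
    IsSubfieldOf (grade0 𝒜) (M ⊓ grade0 𝒜) := by
  refine ⟨inf_le_right, fun x hx y hy => hM.2 x hx.1 y hy.1, fun x hx hx0 => ?_⟩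
  obtain ⟨y, hy, h1, h2⟩ := exists_inv_mem_grade0 𝒜 hD hx.2 hx0
  obtain ⟨z, hz, h3, -⟩ := hM.1.2 0 x hx.1 hx.2 hx0
  have : y = z := left_inv_eq_right_inv h2 h3
  exact ⟨y, ⟨this ▸ hz, hy⟩, h1, h2⟩

theorem unitVal_inv_mem (hM : IsGradedDivSubring 𝒜 M) {g : homogUnits 𝒜}
    (hg : unitVal 𝒜 g ∈ M) : unitVal 𝒜 g⁻¹ ∈ M := by
  by_cases h0 : unitVal 𝒜 g = 0
  · have h1 : (1 : D) = 0 := by rw [← unitVal_mul_inv 𝒜 g, h0, zero_mul]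
    have h2 : unitVal 𝒜 g⁻¹ = 0 := by rw [← one_mul (unitVal 𝒜 g⁻¹), h1, zero_mul]
    rw [h2]
    exact zero_mem M
  · obtain ⟨γ, hγ⟩ := g.2
    obtain ⟨z, hz, h3, -⟩ := hM.2 γ _ hg hγ h0
    have : unitVal 𝒜 g⁻¹ = z := left_inv_eq_right_inv (unitVal_inv_mul 𝒜 g) h3
    exact this ▸ hz

theorem cen0_le_of_isMaxSubfieldOf (hD : IsGradedDivisionRing 𝒜) (hM : IsGradedSubfield 𝒜 M)
    (hmax : IsMaxSubfieldOf (grade0 𝒜) (M ⊓ grade0 𝒜)) : cen0 𝒜 ≤ M := fun z hz =>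
  ((isMaxSubfieldOf_grade0_iff 𝒜 hD (isSubfieldOf_inf_grade0 hD hM)).mp hmax z hz.2
    fun y hy => (((mem_cen0 𝒜).mp hz).1 y hy.2).symm).1

variable [Nontrivial D]

/-- The homogeneous units commuting with `D₀` whose degree is a degree of `M`. -/
def centUnitsOver (hD : IsGradedDivisionRing 𝒜) (hM : IsGradedDivSubring 𝒜 M) :
    Subgroup (homogUnits 𝒜) :=
  centUnits 𝒜 (grade0 𝒜 : Set D) ⊓ (gradeGroup 𝒜 hD hM).comap (udeg 𝒜)

theorem mem_centUnitsOver {hD : IsGradedDivisionRing 𝒜} {hM : IsGradedDivSubring 𝒜 M}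
    {x : homogUnits 𝒜} : x ∈ centUnitsOver hD hM ↔
      x ∈ centUnits 𝒜 (grade0 𝒜 : Set D) ∧ ∃ m, unitVal 𝒜 m ∈ M ∧ udeg 𝒜 m = udeg 𝒜 x :=
  and_congr_right fun _ => mem_gradeGroup_iff 𝒜 hD hM

/-- If `M` contains `Z(D₀)`, each unit of `M` is a unit of `D₀` times one commuting with `D₀`. -/
theorem exists_mem_centUnitsOver (hD : IsGradedDivisionRing 𝒜)
    (hfin : Module.Finite (Subring.center D) D) (hM : IsGradedSubfield 𝒜 M) (hZ : cen0 𝒜 ≤ M)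
    {m : homogUnits 𝒜} (hm : unitVal 𝒜 m ∈ M) :
    ∃ x ∈ centUnitsOver hD hM.1, udeg 𝒜 x = udeg 𝒜 m := by
  obtain ⟨x, hx, hxm⟩ := exists_mem_centUnits_grade0 hD hfin (g := m)
    fun y hy => hM.2 _ hm y (hZ hy)
  exact ⟨x, mem_centUnitsOver.mpr ⟨hx, m, hm, hxm.symm⟩, hxm⟩

theorem map_udeg_centUnitsOver (hD : IsGradedDivisionRing 𝒜)
    (hfin : Module.Finite (Subring.center D) D) (hM : IsGradedSubfield 𝒜 M) (hZ : cen0 𝒜 ≤ M) :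
    (centUnitsOver hD hM.1).map (udeg 𝒜) = gradeGroup 𝒜 hD hM.1 := by
  refine le_antisymm ?_ fun γ hγ => ?_
  · rintro _ ⟨x, hx, rfl⟩
    exact hx.2
  · obtain ⟨m, hm, rfl⟩ := (mem_gradeGroup_iff 𝒜 hD _).mp hγ
    exact exists_mem_centUnitsOver hD hfin hM hZ hm

theorem unitVal_mem_of_mem_centralizer (hD : IsGradedDivisionRing 𝒜)
    (hfin : Module.Finite (Subring.center D) D) (hM : IsMaxGradedSubfieldOf 𝒜 ⊤ M)
    (hZ : cen0 𝒜 ≤ M) {x : homogUnits 𝒜} (hx : x ∈ centUnits 𝒜 (grade0 𝒜 : Set D))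
    (hxH : x ∈ Subgroup.centralizer (centUnitsOver hD hM.1.1 : Set (homogUnits 𝒜))) :
    unitVal 𝒜 x ∈ M := by
  refine hM.mem_of_commute_unitVal hD (unitVal_mem 𝒜 x) fun m hm => ?_
  obtain ⟨c, hc, hcm⟩ := exists_mem_centUnitsOver hD hfin hM.1 hZ hm
  have h1 : unitVal 𝒜 x * unitVal 𝒜 (m * c⁻¹) = unitVal 𝒜 (m * c⁻¹) * unitVal 𝒜 x :=
    hx _ (unitVal_mem_grade0 𝒜 (by rw [map_mul, map_inv, hcm, mul_inv_cancel]))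
  rw [← map_mul, ← map_mul] at h1
  have h2 : Commute x (m * c⁻¹) := unitVal_injective 𝒜 h1
  have h3 : Commute x c := (Subgroup.mem_centralizer_iff.mp hxH c hc).symm
  have h4 : Commute x m := by simpa using h2.mul_right h3
  rw [← map_mul, h4.eq, map_mul]

/-- If `M` contains `Z(D₀)` and the units commuting with `D₀` of the degrees of `M`, then `M₀` is a
maximal subfield of `D₀`. -/
theorem isMaxSubfieldOf_of_centUnitsOver (hD : IsGradedDivisionRing 𝒜)
    (hfin : Module.Finite (Subring.center D) D) (hM : IsMaxGradedSubfieldOf 𝒜 ⊤ M)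
    (hZ : cen0 𝒜 ≤ M) (hH : ∀ x ∈ centUnitsOver hD hM.1.1, unitVal 𝒜 x ∈ M) :
    IsMaxSubfieldOf (grade0 𝒜) (M ⊓ grade0 𝒜) := by
  refine (isMaxSubfieldOf_grade0_iff 𝒜 hD (isSubfieldOf_inf_grade0 hD hM.1)).mpr
    fun b hb hbM => ⟨?_, hb⟩
  refine hM.mem_of_commute_unitVal hD hb fun m hm => ?_
  obtain ⟨x, hx, hxm⟩ := exists_mem_centUnitsOver hD hfin hM.1 hZ hm
  have h1 : b * unitVal 𝒜 (m * x⁻¹) = unitVal 𝒜 (m * x⁻¹) * b := by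
    refine hbM _ ⟨?_, unitVal_mem_grade0 𝒜 (by rw [map_mul, map_inv, hxm, mul_inv_cancel])⟩
    rw [map_mul]
    exact mul_mem hm (unitVal_inv_mem hM.1.1 (hH x hx))
  have h2 : Commute b (unitVal 𝒜 x) := (hx.1 b hb).symm
  have h3 := (show Commute b (unitVal 𝒜 (m * x⁻¹)) from h1).mul_right h2
  rw [← map_mul, inv_mul_cancel_right] at h3
  exact h3.eq

theorem unitVal_mem_of_isMaxSubfieldOf (hD : IsGradedDivisionRing 𝒜) (hM : IsGradedSubfield 𝒜 M)
    (hmax : IsMaxSubfieldOf (grade0 𝒜) (M ⊓ grade0 𝒜)) {x : homogUnits 𝒜}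
    (hx : x ∈ centUnitsOver hD hM.1) : unitVal 𝒜 x ∈ M := by
  obtain ⟨hx, m, hm, hmx⟩ := mem_centUnitsOver.mp hx
  have h0 : unitVal 𝒜 (m * x⁻¹) ∈ grade0 𝒜 :=
    unitVal_mem_grade0 𝒜 (by rw [map_mul, map_inv, hmx, mul_inv_cancel])
  have h1 := (isMaxSubfieldOf_grade0_iff 𝒜 hD (isSubfieldOf_inf_grade0 hD hM)).mp hmax _ h0
    fun y hy => by
      have h2 : Commute (unitVal 𝒜 m) y := hM.2 _ hm y hy.1
      have h3 : Commute (unitVal 𝒜 x⁻¹) y := inv_mem hx y hy.2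
      rw [map_mul]
      exact (h2.mul_left h3).eq
  have h4 := mul_mem (unitVal_inv_mem hM.1 h1.1) hm
  rwa [← map_mul, mul_inv_rev, inv_inv, inv_mul_cancel_right] at h4

/-- If `M ∩ 𝖢` is a maximal graded subfield of `𝖢`, then `M₀` is a maximal subfield of `D₀`. -/
theorem isMaxSubfieldOf_of_isMaxGradedSubfieldOf_inf_Cc (hD : IsGradedDivisionRing 𝒜)
    (hfin : Module.Finite (Subring.center D) D) (hM : IsMaxGradedSubfieldOf 𝒜 ⊤ M)
    (hL : IsMaxGradedSubfieldOf 𝒜 (Cc 𝒜 (Subring.center D)) (M ⊓ Cc 𝒜 (Subring.center D))) :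
    IsMaxSubfieldOf (grade0 𝒜) (M ⊓ grade0 𝒜) := by
  rw [Cc_center] at hL
  have hC : IsGradedDivSubring 𝒜 (Subring.centralizer (grade0 𝒜 : Set D)) :=
    isGradedDivSubring_centralizer 𝒜 hD _ (isGradedSubring_grade0 𝒜)
  refine isMaxSubfieldOf_of_centUnitsOver hD hfin hM (fun z hz => ?_) fun x hx => ?_
  · exact (hL.mem_of_commute hD hC hz.2 hz.1 fun y hy =>
      (Subring.mem_centralizer_iff.mp hy.2 z hz.2)).1
  · obtain ⟨hx, m, hm, hmx⟩ := mem_centUnitsOver.mp hx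
    refine (hL.mem_of_commute hD hC (unitVal_mem 𝒜 x)
      ((unitVal_mem_centralizer_iff 𝒜).mpr hx) fun y hy => ?_).1
    have h0 : unitVal 𝒜 (x * m⁻¹) ∈ grade0 𝒜 :=
      unitVal_mem_grade0 𝒜 (by rw [map_mul, map_inv, hmx, mul_inv_cancel])
    have h1 : Commute (unitVal 𝒜 (x * m⁻¹)) y := Subring.mem_centralizer_iff.mp hy.2 _ h0
    have h2 : Commute (unitVal 𝒜 m) y := hM.1.2 _ hm y hy.1
    have h3 := h1.mul_left h2
    rw [← map_mul, inv_mul_cancel_right] at h3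
    exact h3.eq

theorem comap_gradeGroup_center_inf_le (hD : IsGradedDivisionRing 𝒜) :
    (gradeGroup 𝒜 hD (isGradedDivSubring_center 𝒜 hD)).comap (udeg 𝒜) ⊓
        centUnits 𝒜 (grade0 𝒜 : Set D) ≤
      Subgroup.centralizer (centUnits 𝒜 (grade0 𝒜 : Set D) : Set (homogUnits 𝒜)) := by
  rintro n ⟨hn, hnC⟩
  rw [Subgroup.mem_centralizer_iff]
  intro c hc
  refine unitVal_injective 𝒜 ?_
  rw [map_mul, map_mul]
  exact Subring.mem_centralizer_iff.mp (Zc_center_le_centralizer 𝒜 (unitVal_mem_Zc hD hnC hn)) _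
    ((unitVal_mem_centralizer_iff 𝒜).mpr hc)

/-- The commutator pairing on the homogeneous units commuting with `D₀` is nondegenerate modulo the
degrees of the center. -/
theorem relIndex_centralizer_inf (hD : IsGradedDivisionRing 𝒜)
    (hfin : Module.Finite (Subring.center D) D) {H : Subgroup (homogUnits 𝒜)}
    (hH : H ≤ centUnits 𝒜 (grade0 𝒜 : Set D)) :
    (centUnits 𝒜 (grade0 𝒜 : Set D) ⊓ Subgroup.centralizer (H : Set (homogUnits 𝒜))).relIndex
        (centUnits 𝒜 (grade0 𝒜 : Set D)) =
      ((gradeGroup 𝒜 hD (isGradedDivSubring_center 𝒜 hD)).comap (udeg 𝒜)).relIndex H := by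
  set Cu := centUnits 𝒜 (grade0 𝒜 : Set D)
  set N := (gradeGroup 𝒜 hD (isGradedDivSubring_center 𝒜 hD)).comap (udeg 𝒜)
  have hdom := isDomain_cen0 hD
  have hNC : N ⊓ Cu ≤ Subgroup.centralizer (Cu : Set (homogUnits 𝒜)) :=
    comap_gradeGroup_center_inf_le hD
  have hN : Subgroup.centralizer (Cu : Set (homogUnits 𝒜)) ⊓ H = N ⊓ H := by
    refine le_antisymm (fun c hc => ⟨?_, hc.2⟩) fun n hn => ⟨hNC ⟨hn.1, hH hn.2⟩, hn.2⟩
    exact udeg_mem_of_mem_centralizer hD hfin (hH hc.2) hc.1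
  have hle : N ⊓ Cu ≤ Subgroup.centralizer (H : Set (homogUnits 𝒜)) :=
    hNC.trans (Subgroup.centralizer_le hH)
  have h1 : (Subgroup.centralizer (Cu : Set (homogUnits 𝒜))).relIndex H = N.relIndex H := by
    rw [← Subgroup.inf_relIndex_right, hN, Subgroup.inf_relIndex_right]
  have h2 : (Subgroup.centralizer (H : Set (homogUnits 𝒜))).relIndex Cu ≠ 0 := by
    refine fun h0 => relIndex_comap_gradeGroup_center_ne_zero hD hfin Cu ?_
    rw [← Subgroup.inf_relIndex_right]
    exact zero_dvd_iff.mp (h0 ▸ Subgroup.relIndex_dvd_of_le_left _ hle)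
  have hcomm : ∀ b ∈ Cu, ∀ k : cen0 𝒜, unitVal 𝒜 b * (cen0 𝒜).subtype k =
      (cen0 𝒜).subtype k * unitVal 𝒜 b := fun b hb k => hb k k.2.2
  rw [Subgroup.inf_relIndex_left, ← h1]
  refine le_antisymm ?_ ?_
  · exact relIndex_centralizer_le (unitVal 𝒜) (unitVal_injective 𝒜) (cen0 𝒜).subtype
      Subtype.val_injective Cu H (fun a _ b hb => ⟨⟨_, commutator_mem_cen0 𝒜 a (hH hb)⟩, rfl⟩)
      (fun b hb => hcomm b (hH hb))
      (h1 ▸ relIndex_comap_gradeGroup_center_ne_zero hD hfin H)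
  · exact relIndex_centralizer_le (unitVal 𝒜) (unitVal_injective 𝒜) (cen0 𝒜).subtype
      Subtype.val_injective H Cu (fun a _ b hb => ⟨⟨_, commutator_mem_cen0 𝒜 a hb⟩, rfl⟩)
      hcomm h2

theorem isMaxSubfieldOf_iff_index (hD : IsGradedDivisionRing 𝒜)
    (hfin : Module.Finite (Subring.center D) D) (hM : IsMaxGradedSubfieldOf 𝒜 ⊤ M)
    (hZ : cen0 𝒜 ≤ M) :
    IsMaxSubfieldOf (grade0 𝒜) (M ⊓ grade0 𝒜) ↔
      addSetIndex (gradeSet 𝒜 M) (gradeSet 𝒜 (Subring.center D)) ^ 2 =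
        relDim (Zc 𝒜 (Subring.center D)) (Cc 𝒜 (Subring.center D)) := by
  set Cu := centUnits 𝒜 (grade0 𝒜 : Set D)
  set N := (gradeGroup 𝒜 hD (isGradedDivSubring_center 𝒜 hD)).comap (udeg 𝒜) with hN
  set H := centUnitsOver hD hM.1.1
  set P := Cu ⊓ Subgroup.centralizer (H : Set (homogUnits 𝒜))
  have hHC : H ≤ Cu := inf_le_left
  have hPM : ∀ x ∈ P, unitVal 𝒜 x ∈ M := fun x hx =>
    unitVal_mem_of_mem_centralizer hD hfin hM hZ hx.1 hx.2
  have hPH : P ≤ H := fun x hx =>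
    mem_centUnitsOver.mpr ⟨hx.1, x, hPM x hx, rfl⟩
  have hiff : IsMaxSubfieldOf (grade0 𝒜) (M ⊓ grade0 𝒜) ↔ P = H := by
    constructor
    · refine fun hmax => le_antisymm hPH fun x hx =>
        ⟨hx.1, Subgroup.mem_centralizer_iff.mpr fun y hy => unitVal_injective 𝒜 ?_⟩
      rw [map_mul, map_mul]
      exact hM.1.2 _ (unitVal_mem_of_isMaxSubfieldOf hD hM.1 hmax hy) _
        (unitVal_mem_of_isMaxSubfieldOf hD hM.1 hmax hx)
    · exact fun h => isMaxSubfieldOf_of_centUnitsOver hD hfin hM hZ fun x hx =>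
        hPM x (h ▸ hx)
  have hNM : addSetIndex (gradeSet 𝒜 M) (gradeSet 𝒜 (Subring.center D)) = N.relIndex H := by
    rw [addSetIndex_gradeSet hD hM.1.1 (isGradedDivSubring_center 𝒜 hD), hN,
      Subgroup.relIndex_comap, map_udeg_centUnitsOver hD hfin hM.1 hZ]
  have hNP : N ⊓ Cu ≤ P :=
    le_inf inf_le_right ((comap_gradeGroup_center_inf_le hD).trans (Subgroup.centralizer_le hHC))
  have hrel : ∀ K ≤ Cu, (N ⊓ Cu).relIndex K = N.relIndex K := fun K hK => by
    rw [← Subgroup.inf_relIndex_right, inf_assoc, inf_eq_right.mpr hK, Subgroup.inf_relIndex_right]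
  have hPC : P.relIndex Cu = N.relIndex H := relIndex_centralizer_inf hD hfin hHC
  have h1 := Subgroup.relIndex_mul_relIndex (N ⊓ Cu) P Cu hNP inf_le_left
  have h2 := Subgroup.relIndex_mul_relIndex (N ⊓ Cu) P H hNP hPH
  have h0 : N.relIndex H ≠ 0 := relIndex_comap_gradeGroup_center_ne_zero hD hfin H
  rw [hrel P inf_le_left, hrel Cu le_rfl, hPC] at h1
  rw [hrel P inf_le_left, hrel H hHC] at h2
  have hP0 : N.relIndex P ≠ 0 := relIndex_comap_gradeGroup_center_ne_zero hD hfin P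
  rw [hiff, hNM, relDim_Zc_Cc hD hfin, ← h1, sq, mul_left_inj' h0, ← h2,
    mul_eq_left₀ hP0, Subgroup.relIndex_eq_one]
  exact ⟨fun h => h.ge, fun h => le_antisymm hPH h⟩

end MaxSubfield

end Graded

/-- for a maximal graded subfield `M` of `D`, `M₀` is a maximal
subfield of `D₀` iff `M ⊇ 𝖹` and `|Γ_M : Γ_𝖹| = deg 𝖢`; this holds whenever `M ⊓ 𝖢`
is a maximal graded subfield of `𝖢`. -/
theorem stmt_11 {Γ : Type*} [AddCommGroup Γ] [DecidableEq Γ] {D : Type*} [Ring D]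
    (hΓ : TorsionFree Γ) (𝒜 : Γ → AddSubgroup D) [GradedRing 𝒜]
    (hD : IsGradedDivisionRing 𝒜)
    (F : Subring D) (hFcen : F = Subring.center D) (hfin : finiteOver F)
    (M : Subring D) (hM : IsMaxGradedSubfieldOf 𝒜 ⊤ M) :
    (IsMaxSubfieldOf (grade0 𝒜) (M ⊓ grade0 𝒜) ↔
      (Zc 𝒜 F ≤ M ∧
        (addSetIndex (gradeSet 𝒜 M) (gradeSet 𝒜 (Zc 𝒜 F))) ^ 2 =
          relDim (Zc 𝒜 F) (Cc 𝒜 F))) ∧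
    (IsMaxGradedSubfieldOf 𝒜 (Cc 𝒜 F) (M ⊓ Cc 𝒜 F) →
      IsMaxSubfieldOf (grade0 𝒜) (M ⊓ grade0 𝒜)) := by
  subst hFcen
  have : Nontrivial D := ⟨0, 1, hD.1⟩
  refine ⟨?_, isMaxSubfieldOf_of_isMaxGradedSubfieldOf_inf_Cc hD hfin hM⟩
  rw [gradeSet_Zc_center hD]
  constructor
  · intro hmax
    have hZ := cen0_le_of_isMaxSubfieldOf hD hM.1 hmax
    exact ⟨sup_le hZ (hM.center_le hD), (isMaxSubfieldOf_iff_index hD hfin hM hZ).mp hmax⟩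
  · rintro ⟨hZ, h⟩
    exact (isMaxSubfieldOf_iff_index hD hfin hM (le_sup_left.trans hZ)).mpr h

end GradedDivPaper
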